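/- Let f ∈ D(μ) ∩ H^∞ be an outer function such that Z̲(f) ∩ supp(μ) = ∅. Then f is cyclic for D(μ). -/

import Mathlib

open MeasureTheory Metric Filter Complex Set
open scoped ENNReal Topology

noncomputable section

namespace DirichletMu

/-- The open unit disc in `ℂ`. -/
def disc : Set ℂ := Metric.ball 0 1

/-- The unit circle `𝕋`. -/
def circleT : Set ℂ := Metric.sphere 0 1

/-- The boundary point `e^{it}`. -/
def bpt (t : ℝ) : ℂ := Complex.exp (Complex.I * (t : ℂ))

/-- Arc-length parametrizing measure on `(0, 2π]`. -/
def θm : Measure ℝ := volume.restrict (Set.Ioc 0 (2 * Real.pi))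

/-- A measure is carried by the unit circle. -/
def OnCircle (μ : Measure ℂ) : Prop := μ circleTᶜ = 0

/-- The mean-square integrals of `f` over circles of radius `r < 1`. -/
def hardySet (f : ℂ → ℂ) : Set ℝ :=
  {x | ∃ r : ℝ, 0 < r ∧ r < 1 ∧
    x = (1 / (2 * Real.pi)) * ∫ t in (0:ℝ)..(2 * Real.pi), ‖f ((r : ℂ) * bpt t)‖ ^ 2}

/-- Membership in the Hardy space `H²`. -/
def MemHardy2 (f : ℂ → ℂ) : Prop :=
  DifferentiableOn ℂ f disc ∧ BddAbove (hardySet f)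

/-- The squared Hardy norm. -/
def hardyNormSq (f : ℂ → ℂ) : ℝ := sSup (hardySet f)

/-- Membership in `H^∞`. -/
def MemHinf (f : ℂ → ℂ) : Prop :=
  DifferentiableOn ℂ f disc ∧ ∃ C : ℝ, ∀ z ∈ disc, ‖f z‖ ≤ C

/-- The sup norm over the disc. -/
def supNorm (f : ℂ → ℂ) : ℝ := sSup ((fun z => ‖f z‖) '' disc)

/-- The Poisson integral of the measure `μ`. -/
def poissonMu (μ : Measure ℂ) (z : ℂ) : ℝ :=
  ∫ ζ, (1 - ‖z‖ ^ 2) / ‖1 - (starRingEnd ℂ) ζ * z‖ ^ 2 ∂μ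

/-- The integrand of the Dirichlet integral. -/
def dirichletDensity (μ : Measure ℂ) (f : ℂ → ℂ) (z : ℂ) : ℝ :=
  ‖deriv f z‖ ^ 2 * poissonMu μ z

/-- The Dirichlet integral `D_μ(f)`. -/
def dirichletIntegral (μ : Measure ℂ) (f : ℂ → ℂ) : ℝ :=
  (1 / Real.pi) * ∫ z in disc, dirichletDensity μ f z

/-- Membership in the Dirichlet-type space `D(μ)`. -/
def MemD (μ : Measure ℂ) (f : ℂ → ℂ) : Prop :=
  MemHardy2 f ∧ IntegrableOn (dirichletDensity μ f) disc

/-- The squared norm `‖f‖_μ²` of `D(μ)`. -/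
def dNormSq (μ : Measure ℂ) (f : ℂ → ℂ) : ℝ :=
  hardyNormSq f + dirichletIntegral μ f

/-- `f` has radial limit `L` at `ζ`. -/
def HasRadialLimitAt (f : ℂ → ℂ) (ζ L : ℂ) : Prop :=
  Tendsto (fun r : ℝ => f ((r : ℂ) * ζ)) (nhdsWithin 1 (Set.Iio 1)) (nhds L)

/-- The modulus of `f` has radial limit `m` at `e^{it}`. -/
def BoundaryAbs (f : ℂ → ℂ) (t : ℝ) (m : ℝ) : Prop :=
  Tendsto (fun r : ℝ => ‖f ((r : ℂ) * bpt t)‖) (nhdsWithin 1 (Set.Iio 1)) (nhds m)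

/-- The boundary zero set `Z_𝕋(f)`. -/
def ZT (f : ℂ → ℂ) : Set ℂ :=
  {ζ | ζ ∈ circleT ∧ HasRadialLimitAt f ζ 0}

/-- The set `Z̲(f)`. -/
def Zlow (f : ℂ → ℂ) : Set ℂ :=
  {ζ | ζ ∈ Metric.closedBall (0 : ℂ) 1 ∧
    Filter.liminf (fun z => ‖f z‖) (nhdsWithin ζ disc) = 0}

def ZlowSet (S : Set (ℂ → ℂ)) : Set ℂ := ⋂ f ∈ S, Zlow f

def ZTSet (S : Set (ℂ → ℂ)) : Set ℂ := ⋂ f ∈ S, ZT f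

/-- `[f]_{D(μ)}`: the closure in `D(μ)` of the polynomial multiples of `f`. -/
def closedSpan (μ : Measure ℂ) (f : ℂ → ℂ) : Set (ℂ → ℂ) :=
  {g | MemD μ g ∧ ∀ ε > 0, ∃ q : Polynomial ℂ,
    dNormSq μ (fun z => g z - q.eval z * f z) < ε}

/-- `f` is cyclic for `D(μ)`. -/
def IsCyclic (μ : Measure ℂ) (f : ℂ → ℂ) : Prop :=
  closedSpan μ f = {g | MemD μ g}

/-- `f` is the outer function with boundary modulus `φ` (parametrized by `e^{it}`). -/
def OuterWith (f : ℂ → ℂ) (φ : ℝ → ℝ) : Prop :=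
  (∀ t, 0 ≤ φ t) ∧
  IntervalIntegrable (fun t => Real.log (φ t)) volume 0 (2 * Real.pi) ∧
  ∀ z ∈ disc, f z = Complex.exp (((2 * Real.pi : ℝ) : ℂ)⁻¹ *
    ∫ t in (0:ℝ)..(2 * Real.pi), ((bpt t + z) / (bpt t - z)) * (Real.log (φ t) : ℂ))

/-- `f` is an outer function. -/
def IsOuter (f : ℂ → ℂ) : Prop := ∃ φ, OuterWith f φ

/-- Inner functions. -/
def IsInner (f : ℂ → ℂ) : Prop :=
  DifferentiableOn ℂ f disc ∧ (∀ z ∈ disc, ‖f z‖ ≤ 1) ∧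
  ∀ᵐ t ∂θm, BoundaryAbs f t 1

/-- `f / Θ ∈ H²`. -/
def InnerDivides (Θ f : ℂ → ℂ) : Prop :=
  ∃ g, MemHardy2 g ∧ ∀ z ∈ disc, f z = Θ z * g z

/-- `Θ / Θ'` is bounded on the disc. -/
def DividesBdd (Θ' Θ : ℂ → ℂ) : Prop :=
  ∃ g, MemHinf g ∧ ∀ z ∈ disc, Θ z = Θ' z * g z

/-- `Θ` is the greatest common inner divisor of the family `M`. -/
def IsGCDInner (M : Set (ℂ → ℂ)) (Θ : ℂ → ℂ) : Prop :=
  IsInner Θ ∧ (∀ f ∈ M, InnerDivides Θ f) ∧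
  ∀ Θ', IsInner Θ' → (∀ f ∈ M, InnerDivides Θ' f) → DividesBdd Θ' Θ

/-- The set `Θ H²`. -/
def innerMulH2 (Θ : ℂ → ℂ) : Set (ℂ → ℂ) :=
  {h | ∃ g, MemHardy2 g ∧ ∀ z ∈ disc, h z = Θ z * g z}

/-- Poisson extension of a boundary function (parametrized by `e^{it}`). -/
def poissonExt (u : ℝ → ℝ) (z : ℂ) : ℝ :=
  (1 / (2 * Real.pi)) * ∫ t in (0:ℝ)..(2 * Real.pi),
    ((1 - ‖z‖ ^ 2) / ‖bpt t - z‖ ^ 2) * u t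

/-- `|∇ P[u]|² P_μ`. -/
def gradDensity (μ : Measure ℂ) (u : ℝ → ℝ) (z : ℂ) : ℝ :=
  ‖fderiv ℝ (poissonExt u) z‖ ^ 2 * poissonMu μ z

/-- Membership in the harmonic Dirichlet space `D^h(μ)`. -/
def MemDh (μ : Measure ℂ) (u : ℝ → ℝ) : Prop :=
  IntegrableOn (fun t => (u t) ^ 2) (Set.Ioc 0 (2 * Real.pi)) volume ∧
  IntegrableOn (gradDensity μ u) disc

/-- The squared norm of `D^h(μ)`. -/
def dhNormSq (μ : Measure ℂ) (u : ℝ → ℝ) : ℝ :=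
  (1 / (2 * Real.pi)) * (∫ t in Set.Ioc 0 (2 * Real.pi), (u t) ^ 2) +
  (1 / Real.pi) * ∫ z in disc, gradDensity μ u z

/-- Relatively open subsets of the circle. -/
def RelOpen (U : Set ℂ) : Prop := ∃ V : Set ℂ, IsOpen V ∧ U = V ∩ circleT

/-- Capacity of a relatively open subset of the circle. -/
def capOpen (μ : Measure ℂ) (U : Set ℂ) : ℝ≥0∞ :=
  ⨅ (u : ℝ → ℝ) (_ : MemDh μ u ∧ (∀ t, 0 ≤ u t) ∧
      ∀ᵐ t ∂θm, bpt t ∈ U → 1 ≤ u t),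
    ENNReal.ofReal (dhNormSq μ u)

/-- The capacity `c_μ` of an arbitrary subset of the circle. -/
def cap (μ : Measure ℂ) (F : Set ℂ) : ℝ≥0∞ :=
  ⨅ (U : Set ℂ) (_ : RelOpen U ∧ F ⊆ U), capOpen μ U

/-- The (closed) support of a measure on `ℂ`. -/
def msupport (μ : Measure ℂ) : Set ℂ :=
  {x | ∀ r > 0, 0 < μ (Metric.ball x r)}

/-- `M_μ(E)`: functions of `D(μ)` whose radial limits vanish `c_μ`-q.e. on `E`. -/
def Mspace (μ : Measure ℂ) (E : Set ℂ) : Set (ℂ → ℂ) :=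
  {g | MemD μ g ∧ ∃ N : Set ℂ, cap μ N = 0 ∧ ∀ ζ ∈ E \ N, HasRadialLimitAt g ζ 0}

/-- Closed shift-invariant subspaces of `D(μ)` (closedness for the `D(μ)` norm). -/
structure ClosedInvSubspace (μ : Measure ℂ) (M : Set (ℂ → ℂ)) : Prop where
  subset : M ⊆ {f | MemD μ f}
  zero_mem : (fun _ => (0 : ℂ)) ∈ M
  add_mem : ∀ f ∈ M, ∀ g ∈ M, (fun z => f z + g z) ∈ M
  smul_mem : ∀ (c : ℂ), ∀ f ∈ M, (fun z => c * f z) ∈ M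
  shift_mem : ∀ f ∈ M, (fun z => z * f z) ∈ M
  closed : ∀ g, MemD μ g →
    (∀ ε > 0, ∃ h ∈ M, dNormSq μ (fun z => g z - h z) < ε) → g ∈ M

/-- The norm `‖f‖_{∞,μ}` of the Banach algebra `D(μ) ∩ H^∞`. -/
def algNorm (μ : Measure ℂ) (f : ℂ → ℂ) : ℝ :=
  supNorm f + Real.sqrt (dirichletIntegral μ f)

/-- Membership in the Banach algebra `D(μ) ∩ H^∞`. -/
def MemA (μ : Measure ℂ) (f : ℂ → ℂ) : Prop := MemD μ f ∧ MemHinf f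

/-- Closed ideals of `D(μ) ∩ H^∞`. -/
structure ClosedIdeal (μ : Measure ℂ) (J : Set (ℂ → ℂ)) : Prop where
  subset : J ⊆ {f | MemA μ f}
  zero_mem : (fun _ => (0 : ℂ)) ∈ J
  add_mem : ∀ f ∈ J, ∀ g ∈ J, (fun z => f z + g z) ∈ J
  mul_mem : ∀ f, MemA μ f → ∀ g ∈ J, (fun z => f z * g z) ∈ J
  closed : ∀ g, MemA μ g →
    (∀ ε > 0, ∃ h ∈ J, algNorm μ (fun z => g z - h z) < ε) → g ∈ J

/-- A multiplier of `D(μ)`. -/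
def IsMultiplier (μ : Measure ℂ) (φ : ℂ → ℂ) : Prop :=
  DifferentiableOn ℂ φ disc ∧ ∀ g, MemD μ g → MemD μ (fun z => φ z * g z)

/-- Distance between two subsets of `ℂ`. -/
def setDist (A B : Set ℂ) : ℝ :=
  sInf ((fun p : ℂ × ℂ => dist p.1 p.2) '' (A ×ˢ B))

/-- `k` is the sum of the power series with coefficients `c` on the unit disc. -/
def HasPowerSeriesOnDisc (c : ℕ → ℂ) (k : ℂ → ℂ) : Prop :=
  ∀ z ∈ disc, HasSum (fun n => c n * z ^ n) (k z)

lemma norm_bpt (t : ℝ) : ‖bpt t‖ = 1 := by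
  rw [bpt, mul_comm, Complex.norm_exp_ofReal_mul_I]

lemma continuous_bpt : Continuous bpt := by unfold bpt; fun_prop

lemma bpt_periodic : Function.Periodic bpt (2 * Real.pi) := by
  intro t
  unfold bpt
  push_cast
  rw [mul_add, Complex.exp_add, mul_comm I (2 * (Real.pi : ℂ)), Complex.exp_two_pi_mul_I, mul_one]

lemma smul_bpt_mem_disc {ρ : ℝ} (h0 : 0 ≤ ρ) (h1 : ρ < 1) (t : ℝ) : (ρ : ℂ) * bpt t ∈ disc := by
  simp [disc, norm_bpt, abs_of_nonneg h0, h1]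

lemma mem_disc {z : ℂ} : z ∈ disc ↔ ‖z‖ < 1 := by simp [disc]

lemma isOpen_disc : IsOpen disc := Metric.isOpen_ball

lemma HasPowerSeriesOnDisc.summable_norm {c : ℕ → ℂ} {k : ℂ → ℂ} (h : HasPowerSeriesOnDisc c k)
    {ρ : ℝ} (h0 : 0 ≤ ρ) (h1 : ρ < 1) : Summable (fun n => ‖c n‖ * ρ ^ n) := by
  have := (h (ρ : ℂ) (by simp [mem_disc, abs_of_nonneg h0, h1])).summable.norm
  simpa [abs_of_nonneg h0] using this

lemma sum_range_norm_sq_eq_integral (c : ℕ → ℂ) (ρ : ℝ) (N : ℕ) :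
    ∑ n ∈ Finset.range N, ‖c n‖ ^ 2 * ρ ^ (2 * n) =
      (2 * Real.pi)⁻¹ * ∫ t in (0:ℝ)..(2 * Real.pi),
        ‖∑ n ∈ Finset.range N, c n * ((ρ : ℂ) * bpt t) ^ n‖ ^ 2 := by
  set p : Polynomial ℂ := ∑ n ∈ Finset.range N, Polynomial.monomial n (c n * (ρ : ℂ) ^ n) with hp
  have h := p.sum_sq_norm_coeff_eq_circleAverage
  have hcoef : ∀ i, p.coeff i = if i ∈ Finset.range N then c i * (ρ : ℂ) ^ i else 0 := by
    intro i
    simp [hp, Polynomial.coeff_monomial]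
  have hsub : p.support ⊆ Finset.range N := by
    intro i hi
    by_contra hn
    exact (Polynomial.mem_support_iff.mp hi) (by rw [hcoef, if_neg hn])
  rw [Finset.sum_subset hsub (fun i _ hi => by
    rw [Polynomial.notMem_support_iff.mp hi]; simp)] at h
  rw [Real.circleAverage, smul_eq_mul] at h
  have e1 : ∑ n ∈ Finset.range N, ‖c n‖ ^ 2 * ρ ^ (2 * n)
      = ∑ n ∈ Finset.range N, ‖p.coeff n‖ ^ 2 := by
    refine Finset.sum_congr rfl fun n hn => ?_
    rw [hcoef, if_pos hn, norm_mul, norm_pow, mul_pow, Complex.norm_real, ← pow_mul,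
      mul_comm n 2, Real.norm_eq_abs, pow_mul |ρ|, sq_abs, ← pow_mul]
  rw [e1, h]
  congr 1
  refine intervalIntegral.integral_congr fun t _ => ?_
  simp only [hp, Polynomial.eval_finsetSum, Polynomial.eval_monomial, circleMap, bpt]
  congr 2
  refine Finset.sum_congr rfl fun n _ => ?_
  rw [mul_pow, mul_comm I]
  push_cast
  ring

/-- Parseval's identity on the circle of radius `ρ`. -/
lemma HasPowerSeriesOnDisc.hasSum_norm_sq {c : ℕ → ℂ} {k : ℂ → ℂ} (h : HasPowerSeriesOnDisc c k)
    {ρ : ℝ} (h0 : 0 ≤ ρ) (h1 : ρ < 1) :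
    HasSum (fun n => ‖c n‖ ^ 2 * ρ ^ (2 * n))
      ((2 * Real.pi)⁻¹ * ∫ t in (0:ℝ)..(2 * Real.pi), ‖k ((ρ : ℂ) * bpt t)‖ ^ 2) := by
  rw [hasSum_iff_tendsto_nat_of_nonneg (fun n => by positivity)]
  simp_rw [sum_range_norm_sq_eq_integral]
  refine Tendsto.const_mul _ ?_
  have hs := h.summable_norm h0 h1
  refine intervalIntegral.tendsto_integral_filter_of_dominated_convergence
    (fun _ => (∑' n, ‖c n‖ * ρ ^ n) ^ 2) ?_ ?_ (by simp) ?_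
  · refine Eventually.of_forall fun N => Continuous.aestronglyMeasurable ?_
    have := continuous_bpt
    fun_prop
  · refine Eventually.of_forall fun N => Eventually.of_forall fun t _ => ?_
    rw [Real.norm_eq_abs, abs_of_nonneg (by positivity)]
    gcongr
    refine (norm_sum_le _ _).trans ?_
    refine le_trans (le_of_eq ?_) (hs.sum_le_tsum (Finset.range N) (fun n _ => by positivity))
    refine Finset.sum_congr rfl fun n _ => ?_
    rw [norm_mul, norm_pow, norm_mul, norm_bpt, mul_one, Complex.norm_real, Real.norm_eq_abs,
      abs_of_nonneg h0]
  · refine Eventually.of_forall fun t _ => ?_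
    exact ((h _ (smul_bpt_mem_disc h0 h1 t)).tendsto_sum_nat.norm).pow 2

lemma lintegral_circle {c : ℕ → ℂ} {k : ℂ → ℂ} (h : HasPowerSeriesOnDisc c k)
    (hk : ContinuousOn k disc) {ρ : ℝ} (h0 : 0 ≤ ρ) (h1 : ρ < 1) :
    ∫⁻ t in Ioo (-Real.pi) Real.pi, ‖k ((ρ : ℂ) * bpt t)‖ₑ ^ 2 =
      ∑' n, ENNReal.ofReal (2 * Real.pi * (‖c n‖ ^ 2 * ρ ^ (2 * n))) := by
  have hs := (h.hasSum_norm_sq h0 h1).mul_left (2 * Real.pi)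
  rw [← mul_assoc, mul_inv_cancel₀ (by positivity), one_mul] at hs
  rw [← ENNReal.ofReal_tsum_of_nonneg (fun n => by positivity) hs.summable, hs.tsum_eq]
  have hc : Continuous (fun t => k ((ρ : ℂ) * bpt t)) :=
    hk.comp_continuous (by have := continuous_bpt; fun_prop) (smul_bpt_mem_disc h0 h1)
  have hper : Function.Periodic (fun t => ‖k ((ρ : ℂ) * bpt t)‖ ^ 2) (2 * Real.pi) := by
    intro t
    simp only [bpt_periodic t]
  have := hper.intervalIntegral_add_eq 0 (-Real.pi)
  rw [zero_add] at this
  rw [this, show -Real.pi + 2 * Real.pi = Real.pi by ring,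
    intervalIntegral.integral_of_le (by linarith [Real.pi_pos]), integral_Ioc_eq_integral_Ioo,
    ofReal_integral_eq_lintegral_ofReal]
  · refine lintegral_congr fun t => ?_
    rw [ENNReal.ofReal_pow (norm_nonneg _), ofReal_norm]
  · exact ((hc.norm.pow 2).integrableOn_Icc).mono_set Ioo_subset_Icc_self
  · exact Eventually.of_forall fun t => by positivity

lemma lintegral_radial (n : ℕ) :
    ∫⁻ ρ in Ioo (0:ℝ) 1, ENNReal.ofReal (ρ * (1 - ρ ^ 2) * (2 * Real.pi * ρ ^ (2 * n))) =
      ENNReal.ofReal (Real.pi / ((n + 1) * (n + 2))) := by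
  rw [← ofReal_integral_eq_lintegral_ofReal]
  · rw [← integral_Ioc_eq_integral_Ioo, ← intervalIntegral.integral_of_le zero_le_one]
    congr 1
    have : ∀ ρ : ℝ, ρ * (1 - ρ ^ 2) * (2 * Real.pi * ρ ^ (2 * n)) =
        2 * Real.pi * (ρ ^ (2 * n + 1) - ρ ^ (2 * n + 3)) := fun ρ => by ring
    simp_rw [this]
    rw [intervalIntegral.integral_const_mul, intervalIntegral.integral_sub (by simp) (by simp),
      integral_pow, integral_pow]
    push_cast
    simp
    field_simp
    ring
  · exact (Continuous.integrableOn_Icc (by fun_prop)).mono_set Ioo_subset_Icc_self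
  · refine (ae_restrict_iff' measurableSet_Ioo).mpr (Eventually.of_forall fun ρ hρ => ?_)
    have : 0 ≤ 1 - ρ ^ 2 := by nlinarith [hρ.1, hρ.2]
    have := hρ.1.le
    simp only [Pi.zero_apply]
    positivity

/-- The weighted Bergman norm in terms of Taylor coefficients. -/
lemma HasPowerSeriesOnDisc.lintegral_disc {c : ℕ → ℂ} {k : ℂ → ℂ} (h : HasPowerSeriesOnDisc c k)
    (hk : ContinuousOn k disc) :
    ∫⁻ z in disc, ‖k z‖ₑ ^ 2 * ENNReal.ofReal (1 - ‖z‖ ^ 2) =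
      ∑' n : ℕ, ENNReal.ofReal (Real.pi / ((n + 1) * (n + 2))) * ‖c n‖ₑ ^ 2 := by
  classical
  set K : ℂ → ℂ := disc.piecewise k 0 with hK
  have hKm : Measurable K := hk.measurable_piecewise continuousOn_const isOpen_disc.measurableSet
  set g : ℂ → ℝ≥0∞ := fun z => ‖K z‖ₑ ^ 2 * ENNReal.ofReal (1 - ‖z‖ ^ 2) with hg
  have hgm : Measurable g := by fun_prop
  have e1 : ∫⁻ z in disc, ‖k z‖ₑ ^ 2 * ENNReal.ofReal (1 - ‖z‖ ^ 2) = ∫⁻ z, g z := by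
    rw [← lintegral_indicator isOpen_disc.measurableSet]
    refine lintegral_congr fun z => ?_
    by_cases hz : z ∈ disc <;> simp [hg, hK, hz]
  rw [e1, ← Complex.lintegral_comp_polarCoord_symm]
  rw [polarCoord_target, Measure.volume_eq_prod, setLIntegral_prod]
  swap
  · have : Measurable (fun p : ℝ × ℝ => Complex.polarCoord.symm p) := by
      simp only [Complex.polarCoord_symm_apply]
      fun_prop
    exact ((ENNReal.measurable_ofReal.comp measurable_fst).smul (hgm.comp this)).aemeasurable
  have e2 : ∀ ρ ∈ Ioi (0:ℝ), (∫⁻ t in Ioo (-Real.pi) Real.pi,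
      ENNReal.ofReal ρ • g (Complex.polarCoord.symm (ρ, t))) =
      (Ioo (0:ℝ) 1).indicator (fun ρ => ∑' n, ENNReal.ofReal
        (ρ * (1 - ρ ^ 2) * (2 * Real.pi * ρ ^ (2 * n))) * ‖c n‖ₑ ^ 2) ρ := by
    intro ρ hρ
    have hρ : 0 < ρ := hρ
    have hpc : ∀ t, Complex.polarCoord.symm (ρ, t) = (ρ : ℂ) * bpt t := by
      intro t
      simp only [Complex.polarCoord_symm_apply, bpt]
      rw [mul_comm I, Complex.exp_mul_I]
      push_cast
      ring
    have hn : ∀ t, ‖(ρ : ℂ) * bpt t‖ = ρ := fun t => by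
      rw [norm_mul, norm_bpt, mul_one, Complex.norm_real, Real.norm_eq_abs, abs_of_pos hρ]
    by_cases h1 : ρ < 1
    · rw [indicator_of_mem (show ρ ∈ Ioo (0:ℝ) 1 from ⟨hρ, h1⟩)]
      have : 0 ≤ 1 - ρ ^ 2 := by nlinarith
      have e3 : ∀ t, ENNReal.ofReal ρ • g (Complex.polarCoord.symm (ρ, t)) =
          ENNReal.ofReal (ρ * (1 - ρ ^ 2)) * ‖k ((ρ : ℂ) * bpt t)‖ₑ ^ 2 := by
        intro t
        rw [hpc, hg]
        simp only [hn, smul_eq_mul, hK]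
        rw [Set.piecewise_eq_of_mem _ _ _ (smul_bpt_mem_disc hρ.le h1 t),
          ENNReal.ofReal_mul hρ.le]
        ring
      simp_rw [e3]
      rw [lintegral_const_mul', lintegral_circle h hk hρ.le h1, ← ENNReal.tsum_mul_left]
      · refine tsum_congr fun n => ?_
        rw [← ofReal_norm, ← ENNReal.ofReal_pow (norm_nonneg _),
          ← ENNReal.ofReal_mul (by positivity), ← ENNReal.ofReal_mul (by positivity)]
        congr 1
        ring
      · exact ENNReal.ofReal_ne_top
    · rw [indicator_of_notMem (fun hm : ρ ∈ Ioo (0:ℝ) 1 => h1 hm.2)]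
      have : ∀ t, ENNReal.ofReal ρ • g (Complex.polarCoord.symm (ρ, t)) = 0 := by
        intro t
        have : (ρ : ℂ) * bpt t ∉ disc := by rw [mem_disc, hn]; exact h1
        rw [hpc, hg]
        simp [hK, this]
      simp_rw [this, lintegral_zero]
  rw [setLIntegral_congr_fun measurableSet_Ioi e2, lintegral_indicator measurableSet_Ioo,
    Measure.restrict_restrict measurableSet_Ioo,
    inter_eq_self_of_subset_left Ioo_subset_Ioi_self, lintegral_tsum]
  · refine tsum_congr fun n => ?_
    rw [lintegral_mul_const', lintegral_radial]
    simp
  · intro n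
    fun_prop

lemma pow_mul_one_add_le_one {r : ℝ} (h0 : 0 ≤ r) (n : ℕ) :
    r ^ n * (1 + (1 - r) * n) ≤ 1 := by
  induction n with
  | zero => simp
  | succ n ih =>
    have h2 : r * (1 + (1 - r) * ((n : ℝ) + 1)) ≤ 1 + (1 - r) * n := by
      have : 0 ≤ (1 - r) ^ 2 * ((n : ℝ) + 1) := by positivity
      nlinarith
    calc r ^ (n + 1) * (1 + (1 - r) * ((n + 1 : ℕ) : ℝ))
        = r ^ n * (r * (1 + (1 - r) * ((n : ℝ) + 1))) := by push_cast; ring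
      _ ≤ r ^ n * (1 + (1 - r) * n) := by gcongr
      _ ≤ 1 := ih

/-- The weighted sums of the averages `r ^ j * s j + (1 - r) * ∑ n < j, r ^ n * s n`
are dominated by those of `s`. -/
lemma sum_average_le {r : ℝ} (h0 : 0 ≤ r) (h1 : r ≤ 1) (s : ℕ → ℝ) (hs : ∀ n, 0 ≤ s n) (J : ℕ) :
    ∑ j ∈ Finset.range J, 1 / (((j : ℝ) + 1) * (j + 2)) *
        (r ^ 2 * (r ^ j * s j + (1 - r) * ∑ n ∈ Finset.range j, r ^ n * s n)) ≤
      ∑ j ∈ Finset.range J, 1 / (((j : ℝ) + 1) * (j + 2)) * s j := by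
  suffices h : ∑ j ∈ Finset.range J, 1 / (((j : ℝ) + 1) * (j + 2)) *
        (r ^ 2 * (r ^ j * s j + (1 - r) * ∑ n ∈ Finset.range j, r ^ n * s n)) +
        r ^ 2 * (1 - r) * (1 / ((J : ℝ) + 1)) * ∑ n ∈ Finset.range J, r ^ n * s n ≤
      ∑ j ∈ Finset.range J, 1 / (((j : ℝ) + 1) * (j + 2)) * s j by
    have h2 : 0 ≤ ∑ n ∈ Finset.range J, r ^ n * s n :=
      Finset.sum_nonneg fun n _ => mul_nonneg (by positivity) (hs n)
    have h3 : 0 ≤ 1 - r := by linarith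
    have : 0 ≤ r ^ 2 * (1 - r) * (1 / ((J : ℝ) + 1)) * ∑ n ∈ Finset.range J, r ^ n * s n := by
      positivity
    linarith
  induction J with
  | zero => simp
  | succ J ih =>
    rw [Finset.sum_range_succ, Finset.sum_range_succ (fun n => r ^ n * s n),
      Finset.sum_range_succ (fun j : ℕ => 1 / (((j : ℝ) + 1) * (j + 2)) * s j)]
    set A := ∑ n ∈ Finset.range J, r ^ n * s n
    have hb : r ^ (J + 2) * (1 + (1 - r) * (J + 1)) ≤ 1 := by
      have h2 := pow_mul_one_add_le_one h0 (J + 1)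
      have h3 : 0 ≤ r ^ (J + 1) * (1 + (1 - r) * ((J + 1 : ℕ) : ℝ)) := by
        have : 0 ≤ 1 - r := by linarith
        positivity
      push_cast at h2 h3
      calc r ^ (J + 2) * (1 + (1 - r) * (J + 1))
          = r * (r ^ (J + 1) * (1 + (1 - r) * (J + 1))) := by ring
        _ ≤ 1 * 1 := by gcongr
        _ = 1 := one_mul 1
    have hw : (1 : ℝ) / ((J + 1) * (J + 2)) * (r ^ (J + 2) * (1 + (1 - r) * (J + 1)) * s J) ≤
        1 / ((J + 1) * (J + 2)) * s J := by
      gcongr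
      exact mul_le_of_le_one_left (hs J) hb
    have e : (1 : ℝ) / ((J + 1) * (J + 2)) * (r ^ 2 * (r ^ J * s J + (1 - r) * A)) +
        r ^ 2 * (1 - r) * (1 / (((J + 1 : ℕ) : ℝ) + 1)) * (A + r ^ J * s J) =
        r ^ 2 * (1 - r) * (1 / ((J : ℝ) + 1)) * A +
        (1 : ℝ) / ((J + 1) * (J + 2)) * (r ^ (J + 2) * (1 + (1 - r) * (J + 1)) * s J) := by
      push_cast
      field_simp
      ring
    linarith

lemma convex_sum_norm_sq_le {r : ℝ} (h0 : 0 ≤ r) (h1 : r ≤ 1) (x : ℕ → ℂ) (j : ℕ) :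
    ‖(r : ℂ) ^ j * x j + (1 - (r : ℂ)) * ∑ n ∈ Finset.range j, (r : ℂ) ^ n * x n‖ ^ 2 ≤
      r ^ j * ‖x j‖ ^ 2 + (1 - r) * ∑ n ∈ Finset.range j, r ^ n * ‖x n‖ ^ 2 := by
  have h2 : 0 ≤ 1 - r := by linarith
  set w : ℕ → ℝ := fun n => if n = j then r ^ j else (1 - r) * r ^ n with hw
  have hsplit : ∀ {E : Type} [AddCommGroup E] [Module ℝ E] (y : ℕ → E),
      ∑ n ∈ Finset.range (j + 1), w n • y n =
        r ^ j • y j + (1 - r) • ∑ n ∈ Finset.range j, r ^ n • y n := by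
    intro E _ _ y
    rw [Finset.sum_range_succ, add_comm, Finset.smul_sum]
    congr 1
    · simp [hw]
    · refine Finset.sum_congr rfl fun n hn => ?_
      rw [hw]
      simp only [(Finset.mem_range.mp hn).ne, if_false, smul_smul]
  have hconv : ConvexOn ℝ univ (fun z : ℂ => ‖z‖ ^ 2) :=
    (convexOn_norm convex_univ).pow (fun _ _ => norm_nonneg _) 2
  have h1w : ∑ n ∈ Finset.range (j + 1), w n = 1 := by
    have := hsplit (fun _ => (1 : ℝ))
    simp only [smul_eq_mul, mul_one] at this
    rw [this, mul_neg_geom_sum]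
    ring
  have := hconv.map_sum_le (t := Finset.range (j + 1)) (w := w) (p := x)
    (fun n _ => by simp only [hw]; split_ifs <;> positivity) h1w (fun _ _ => mem_univ _)
  rw [hsplit x, hsplit (fun n => ‖x n‖ ^ 2)] at this
  simpa only [real_smul, smul_eq_mul, ofReal_pow, ofReal_sub, ofReal_one] using this

lemma HasPowerSeriesOnDisc.div_one_sub {c : ℕ → ℂ} {h : ℂ → ℂ} (hh : HasPowerSeriesOnDisc c h)
    {a : ℂ} (ha : ‖a‖ ≤ 1) :
    HasPowerSeriesOnDisc (fun n => ∑ m ∈ Finset.range (n + 1), c m * a ^ (n - m))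
      (fun z => h z / (1 - a * z)) := by
  intro z hz
  have hz1 := mem_disc.mp hz
  have haz : ‖a * z‖ < 1 := by
    rw [norm_mul]
    exact lt_of_le_of_lt (mul_le_of_le_one_left (norm_nonneg _) ha) hz1
  have hg := hasSum_geometric_of_norm_lt_one haz
  have hsg : Summable (fun n => ‖(a * z) ^ n‖) := by
    simpa [norm_pow] using summable_geometric_of_lt_one (norm_nonneg _) haz
  have := hasSum_sum_range_mul_of_summable_norm (hh z hz).summable.norm hsg
  rw [(hh z hz).tsum_eq, hg.tsum_eq, ← div_eq_mul_inv] at this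
  convert! this using 2 with n
  rw [Finset.sum_mul]
  refine Finset.sum_congr rfl fun m hm => ?_
  have : m ≤ n := by simpa [Nat.lt_succ_iff] using hm
  rw [mul_pow]
  conv_lhs => rw [← Nat.add_sub_of_le this, pow_add]
  simp only [Nat.add_sub_cancel_left]
  ring

lemma sum_dilation_eq (c : ℕ → ℂ) (a r : ℂ) (j : ℕ) :
    ∑ m ∈ Finset.range (j + 1), r ^ m * c m * a ^ (j - m) =
      r ^ j * ∑ m ∈ Finset.range (j + 1), c m * a ^ (j - m) +
      (1 - r) * ∑ n ∈ Finset.range j,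
        r ^ n * (a ^ (j - n) * ∑ m ∈ Finset.range (n + 1), c m * a ^ (n - m)) := by
  have step : ∀ (d : ℕ → ℂ) (j : ℕ), ∑ m ∈ Finset.range (j + 1 + 1), d m * a ^ (j + 1 - m) =
      a * ∑ m ∈ Finset.range (j + 1), d m * a ^ (j - m) + d (j + 1) := by
    intro d j
    rw [Finset.sum_range_succ, Nat.sub_self, pow_zero, mul_one, Finset.mul_sum]
    congr 1
    refine Finset.sum_congr rfl fun m hm => ?_
    rw [Nat.succ_sub (by simpa [Nat.lt_succ_iff] using hm), pow_succ]
    ring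
  induction j with
  | zero => simp
  | succ j ih =>
    rw [step, step, ih, Finset.sum_range_succ (fun n =>
      r ^ n * (a ^ (j + 1 - n) * ∑ m ∈ Finset.range (n + 1), c m * a ^ (n - m))) j]
    have : ∑ n ∈ Finset.range j,
        r ^ n * (a ^ (j + 1 - n) * ∑ m ∈ Finset.range (n + 1), c m * a ^ (n - m)) =
        a * ∑ n ∈ Finset.range j,
        r ^ n * (a ^ (j - n) * ∑ m ∈ Finset.range (n + 1), c m * a ^ (n - m)) := by
      rw [Finset.mul_sum]
      refine Finset.sum_congr rfl fun n hn => ?_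
      rw [Nat.succ_sub (Finset.mem_range.mp hn).le, pow_succ]
      ring
    rw [this, show j + 1 - j = 1 by simp]
    ring

/-- The kernel `(1 - |z|²) / |1 - ζ̄ z|²`. -/
def poissonWeight (ζ z : ℂ) : ℝ≥0∞ :=
  ENNReal.ofReal ((1 - ‖z‖ ^ 2) / ‖1 - (starRingEnd ℂ) ζ * z‖ ^ 2)

lemma one_sub_mul_ne_zero {a z : ℂ} (ha : ‖a‖ ≤ 1) (hz : z ∈ disc) : 1 - a * z ≠ 0 := by
  intro h
  have h1 : ‖a * z‖ = 1 := by rw [← sub_eq_zero.mp h, norm_one]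
  rw [norm_mul] at h1
  have := mem_disc.mp hz
  nlinarith [norm_nonneg a, norm_nonneg z]

lemma lintegral_poissonWeight {c : ℕ → ℂ} {h : ℂ → ℂ} (hh : HasPowerSeriesOnDisc c h)
    (hc : ContinuousOn h disc) {ζ : ℂ} (hζ : ‖ζ‖ ≤ 1) :
    ∫⁻ z in disc, ‖h z‖ₑ ^ 2 * poissonWeight ζ z =
      ∑' n : ℕ, ENNReal.ofReal (Real.pi / ((n + 1) * (n + 2))) *
        ‖∑ m ∈ Finset.range (n + 1), c m * (starRingEnd ℂ) ζ ^ (n - m)‖ₑ ^ 2 := by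
  have ha : ‖(starRingEnd ℂ) ζ‖ ≤ 1 := by simpa using hζ
  rw [← (hh.div_one_sub ha).lintegral_disc
    (hc.div (by fun_prop) (fun z hz => one_sub_mul_ne_zero ha hz))]
  refine setLIntegral_congr_fun isOpen_disc.measurableSet fun z hz => ?_
  have hne := norm_pos_iff.mpr (one_sub_mul_ne_zero ha hz)
  have h1 : 0 ≤ 1 - ‖z‖ ^ 2 := by nlinarith [norm_nonneg z, mem_disc.mp hz]
  simp only [poissonWeight]
  rw [← ofReal_norm, ← ofReal_norm, ← ENNReal.ofReal_pow (norm_nonneg _),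
    ← ENNReal.ofReal_pow (norm_nonneg _), ← ENNReal.ofReal_mul (by positivity),
    ← ENNReal.ofReal_mul (by positivity), norm_div]
  congr 1
  field_simp

/-- Dilations do not increase the Dirichlet integral with respect to a point mass. -/
lemma lintegral_dilation_le {c : ℕ → ℂ} {h : ℂ → ℂ} (hh : HasPowerSeriesOnDisc c h)
    (hc : ContinuousOn h disc) {ζ : ℂ} (hζ : ‖ζ‖ ≤ 1) {r : ℝ} (h0 : 0 ≤ r) (h1 : r ≤ 1) :
    ∫⁻ z in disc, ‖(r : ℂ) * h (r * z)‖ₑ ^ 2 * poissonWeight ζ z ≤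
      ∫⁻ z in disc, ‖h z‖ₑ ^ 2 * poissonWeight ζ z := by
  have hmem : ∀ z ∈ disc, (r : ℂ) * z ∈ disc := by
    intro z hz
    rw [mem_disc] at hz ⊢
    rw [norm_mul, Complex.norm_real, Real.norm_eq_abs, abs_of_nonneg h0]
    exact lt_of_le_of_lt (mul_le_of_le_one_left (norm_nonneg _) h1) hz
  have hh' : HasPowerSeriesOnDisc (fun n => (r : ℂ) ^ n * (r * c n))
      (fun z => (r : ℂ) * h (r * z)) := by
    intro z hz
    convert! (hh _ (hmem z hz)).mul_left (r : ℂ) using 2 with n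
    rw [mul_pow]
    ring
  have hc' : ContinuousOn (fun z => (r : ℂ) * h (r * z)) disc :=
    continuousOn_const.mul (hc.comp (by fun_prop) hmem)
  rw [lintegral_poissonWeight hh hc hζ, lintegral_poissonWeight hh' hc' hζ]
  set a := (starRingEnd ℂ) ζ with ha_def
  have ha : ‖a‖ ≤ 1 := by simpa [ha_def] using hζ
  set S : ℕ → ℂ := fun n => ∑ m ∈ Finset.range (n + 1), c m * a ^ (n - m) with hS
  have key : ∀ j, ‖∑ m ∈ Finset.range (j + 1), (r : ℂ) ^ m * (r * c m) * a ^ (j - m)‖ ^ 2 ≤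
      r ^ 2 * (r ^ j * ‖S j‖ ^ 2 + (1 - r) * ∑ n ∈ Finset.range j, r ^ n * ‖S n‖ ^ 2) := by
    intro j
    have e : ∑ m ∈ Finset.range (j + 1), (r : ℂ) ^ m * (r * c m) * a ^ (j - m) =
        r * ((r : ℂ) ^ j * (a ^ (j - j) * S j) +
          (1 - (r : ℂ)) * ∑ n ∈ Finset.range j, (r : ℂ) ^ n * (a ^ (j - n) * S n)) := by
      rw [Nat.sub_self, pow_zero, one_mul, hS, ← sum_dilation_eq, Finset.mul_sum]
      exact Finset.sum_congr rfl fun m _ => by ring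
    rw [e, norm_mul, mul_pow, Complex.norm_real, Real.norm_eq_abs, sq_abs]
    gcongr
    refine (convex_sum_norm_sq_le h0 h1 (fun n => a ^ (j - n) * S n) j).trans ?_
    have : ∀ n, ‖a ^ (j - n) * S n‖ ≤ ‖S n‖ := fun n => by
      rw [norm_mul, norm_pow]
      exact mul_le_of_le_one_left (norm_nonneg _) (pow_le_one₀ (norm_nonneg _) ha)
    have h2 : 0 ≤ 1 - r := by linarith
    gcongr <;> exact this _
  refine ENNReal.tsum_le_of_sum_range_le fun J => ?_
  refine le_trans ?_ (ENNReal.sum_le_tsum (Finset.range J))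
  have conv : ∀ d : ℕ → ℂ, ∑ n ∈ Finset.range J,
      ENNReal.ofReal (Real.pi / (((n : ℝ) + 1) * (n + 2))) * ‖d n‖ₑ ^ 2 =
      ENNReal.ofReal (Real.pi *
        ∑ n ∈ Finset.range J, 1 / (((n : ℝ) + 1) * (n + 2)) * ‖d n‖ ^ 2) := by
    intro d
    rw [Finset.mul_sum, ENNReal.ofReal_sum_of_nonneg (fun n _ => by positivity)]
    refine Finset.sum_congr rfl fun n _ => ?_
    rw [← ofReal_norm, ← ENNReal.ofReal_pow (norm_nonneg _), ← ENNReal.ofReal_mul (by positivity)]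
    congr 1
    ring
  rw [conv, conv]
  refine ENNReal.ofReal_le_ofReal ?_
  gcongr Real.pi * ?_
  refine le_trans ?_ (sum_average_le h0 h1 (fun n => ‖S n‖ ^ 2) (fun n => by positivity) J)
  gcongr with j hj
  exact key j

/-- The weight `∫ (1 - |z|²) / |1 - ζ̄ z|² dν(ζ)`. -/
def weight (ν : Measure ℂ) (z : ℂ) : ℝ≥0∞ := ∫⁻ ζ, poissonWeight ζ z ∂ν

/-- Area measure on the disc with density `weight ν`. -/
def discMeasure (ν : Measure ℂ) : Measure ℂ := (volume.restrict disc).withDensity (weight ν)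

/-- The Dirichlet energy of `F` with respect to `ν`, as an extended nonnegative number. -/
def energy (ν : Measure ℂ) (F : ℂ → ℂ) : ℝ≥0∞ := ∫⁻ z, ‖deriv F z‖ₑ ^ 2 ∂(discMeasure ν)

lemma measurable_poissonWeight : Measurable (fun p : ℂ × ℂ => poissonWeight p.2 p.1) := by
  unfold poissonWeight
  have : Continuous (starRingEnd ℂ) := Complex.continuous_conj
  have := this.measurable
  fun_prop

lemma measurable_weight (ν : Measure ℂ) [SFinite ν] : Measurable (weight ν) :=
  measurable_poissonWeight.lintegral_prod_right'

lemma lintegral_discMeasure' (ν : Measure ℂ) [SFinite ν] {g : ℂ → ℝ≥0∞} (hg : Measurable g) :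
    ∫⁻ z, g z ∂(discMeasure ν) = ∫⁻ z in disc, g z * weight ν z := by
  rw [discMeasure, lintegral_withDensity_eq_lintegral_mul _ (measurable_weight ν) hg]
  exact lintegral_congr fun z => mul_comm _ _

lemma lintegral_discMeasure (ν : Measure ℂ) [SFinite ν] {g : ℂ → ℝ≥0∞} (hg : Measurable g) :
    ∫⁻ z, g z ∂(discMeasure ν) = ∫⁻ ζ, (∫⁻ z in disc, g z * poissonWeight ζ z) ∂ν := by
  have hm : Measurable (fun p : ℂ × ℂ => g p.1 * poissonWeight p.2 p.1) :=
    (hg.comp measurable_fst).mul measurable_poissonWeight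
  rw [lintegral_discMeasure' ν hg]
  refine Eq.trans (lintegral_congr fun z => ?_) (lintegral_lintegral_swap
    (f := fun z ζ => g z * poissonWeight ζ z) hm.aemeasurable)
  rw [weight]
  exact (lintegral_const_mul _
    (measurable_poissonWeight.comp (measurable_const.prodMk measurable_id))).symm

lemma ae_mem_disc (ν : Measure ℂ) : ∀ᵐ z ∂(discMeasure ν), z ∈ disc :=
  (withDensity_absolutelyContinuous _ _).ae_le (ae_restrict_mem isOpen_disc.measurableSet)

lemma aemeasurable_discMeasure (ν : Measure ℂ) {g : ℂ → ℂ} (hg : ContinuousOn g disc) :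
    AEMeasurable g (discMeasure ν) :=
  (hg.aemeasurable isOpen_disc.measurableSet).mono_ac (withDensity_absolutelyContinuous _ _)

lemma measurable_energy_integrand (F : ℂ → ℂ) : Measurable (fun z => ‖deriv F z‖ₑ ^ 2) :=
  (measurable_deriv F).enorm.pow_const 2

/-- The Taylor coefficients of `F` at the origin. -/
def taylorCoeff (F : ℂ → ℂ) (n : ℕ) : ℂ := (n.factorial : ℂ)⁻¹ * iteratedDeriv n F 0

lemma hasPowerSeriesOnDisc_taylorCoeff {F : ℂ → ℂ} (hF : DifferentiableOn ℂ F disc) :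
    HasPowerSeriesOnDisc (taylorCoeff F) F := by
  intro z hz
  have := Complex.hasSum_taylorSeries_on_ball hF hz
  convert! this using 2 with n
  simp only [taylorCoeff, sub_zero, smul_eq_mul]
  ring

lemma taylorCoeff_deriv (F : ℂ → ℂ) (n : ℕ) :
    taylorCoeff (deriv F) n = ((n : ℂ) + 1) * taylorCoeff F (n + 1) := by
  have : (n : ℂ) + 1 ≠ 0 := Nat.cast_add_one_ne_zero n
  rw [taylorCoeff, taylorCoeff, iteratedDeriv_succ', Nat.factorial_succ]
  push_cast
  field_simp

lemma taylorCoeff_zero (F : ℂ → ℂ) : taylorCoeff F 0 = F 0 := by simp [taylorCoeff]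

lemma differentiableOn_deriv {F : ℂ → ℂ} (hF : DifferentiableOn ℂ F disc) :
    DifferentiableOn ℂ (deriv F) disc := hF.deriv isOpen_disc

lemma discMeasure_univ_le (ν : Measure ℂ) [SFinite ν] (hν : ∀ᵐ ζ ∂ν, ‖ζ‖ ≤ 1) :
    discMeasure ν univ ≤ ENNReal.ofReal Real.pi * ν univ := by
  rw [← lintegral_one, lintegral_discMeasure ν measurable_const, ← lintegral_const]
  refine lintegral_mono_ae (hν.mono fun ζ hζ => ?_)
  have h1 : HasPowerSeriesOnDisc (fun n => if n = 0 then 1 else 0) (fun _ => 1) := by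
    intro z _
    convert! hasSum_ite_eq 0 (1 : ℂ) using 2 with n
    split_ifs with h <;> simp [h]
  have := lintegral_poissonWeight h1 continuousOn_const hζ
  simp only [enorm_one, one_pow] at this
  rw [this]
  refine ENNReal.tsum_le_of_sum_range_le fun N => ?_
  calc _ ≤ ∑ n ∈ Finset.range N, ENNReal.ofReal (Real.pi / (((n : ℝ) + 1) * (n + 2))) := by
        refine Finset.sum_le_sum fun n _ => ?_
        refine mul_le_of_le_one_right' ?_
        refine pow_le_one₀ (by simp) ?_
        rw [Finset.sum_eq_single_of_mem 0 (by simp) (fun m _ hm => by simp [hm])]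
        simp only [if_true, one_mul, Nat.sub_zero]
        rw [enorm_pow]
        refine pow_le_one₀ (by simp) ?_
        rw [← ofReal_norm, RCLike.norm_conj]
        exact ENNReal.ofReal_le_one.mpr hζ
    _ = ENNReal.ofReal (Real.pi * (1 - 1 / ((N : ℝ) + 1))) := by
        rw [← ENNReal.ofReal_sum_of_nonneg (fun n _ => by positivity)]
        congr 1
        induction N with
        | zero => simp
        | succ N ih =>
          rw [Finset.sum_range_succ, ih]
          push_cast
          field_simp
          ring
    _ ≤ ENNReal.ofReal Real.pi := by
        refine ENNReal.ofReal_le_ofReal (mul_le_of_le_one_right Real.pi_pos.le ?_)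
        have : 0 ≤ 1 / ((N : ℝ) + 1) := by positivity
        linarith

lemma isFiniteMeasure_discMeasure (ν : Measure ℂ) [IsFiniteMeasure ν] (hν : ∀ᵐ ζ ∂ν, ‖ζ‖ ≤ 1) :
    IsFiniteMeasure (discMeasure ν) :=
  ⟨(discMeasure_univ_le ν hν).trans_lt (ENNReal.mul_lt_top ENNReal.ofReal_lt_top
    (measure_lt_top ν univ))⟩

lemma energy_dilation_le (ν : Measure ℂ) [SFinite ν] (hν : ∀ᵐ ζ ∂ν, ‖ζ‖ ≤ 1) {F : ℂ → ℂ}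
    (hF : DifferentiableOn ℂ F disc) {r : ℝ} (h0 : 0 ≤ r) (h1 : r ≤ 1) :
    energy ν (fun z => F (r * z)) ≤ energy ν F := by
  rw [energy, energy, lintegral_discMeasure _ (measurable_energy_integrand _),
    lintegral_discMeasure _ (measurable_energy_integrand _)]
  refine lintegral_mono_ae (hν.mono fun ζ hζ => ?_)
  have hd := differentiableOn_deriv hF
  simp_rw [deriv_comp_mul_left, smul_eq_mul]
  exact lintegral_dilation_le (hasPowerSeriesOnDisc_taylorCoeff hd) hd.continuousOn hζ h0 h1

lemma enorm_add_sq_le (a b : ℂ) : ‖a + b‖ₑ ^ 2 ≤ 2 * ‖a‖ₑ ^ 2 + 2 * ‖b‖ₑ ^ 2 := by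
  simp only [← ofReal_norm, ← ENNReal.ofReal_pow (norm_nonneg _)]
  rw [show (2 : ℝ≥0∞) = ENNReal.ofReal 2 by simp, ← ENNReal.ofReal_mul (by norm_num),
    ← ENNReal.ofReal_mul (by norm_num), ← ENNReal.ofReal_add (by positivity) (by positivity)]
  refine ENNReal.ofReal_le_ofReal ?_
  have := norm_add_le a b
  nlinarith [sq_nonneg (‖a‖ - ‖b‖), norm_nonneg (a + b), norm_nonneg a, norm_nonneg b]

lemma enorm_parallelogram (a b : ℂ) :
    ‖a + b‖ₑ ^ 2 + ‖a - b‖ₑ ^ 2 = 2 * ‖a‖ₑ ^ 2 + 2 * ‖b‖ₑ ^ 2 := by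
  simp only [← ofReal_norm, ← ENNReal.ofReal_pow (norm_nonneg _)]
  rw [show (2 : ℝ≥0∞) = ENNReal.ofReal 2 by simp, ← ENNReal.ofReal_mul (by norm_num),
    ← ENNReal.ofReal_mul (by norm_num), ← ENNReal.ofReal_add (by positivity) (by positivity),
    ← ENNReal.ofReal_add (by positivity) (by positivity)]
  congr 1
  have := parallelogram_law_with_norm ℝ a b
  nlinarith

/-- Pointwise convergence without increase of the square norm implies norm convergence. -/
lemma tendsto_lintegral_sub_sq {α : Type*} [MeasurableSpace α] {m : Measure α} {u : ℕ → α → ℂ}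
    {v : α → ℂ} (hu : ∀ n, Measurable (u n)) (hv : Measurable v)
    (hlim : ∀ᵐ x ∂m, Tendsto (fun n => u n x) atTop (𝓝 (v x)))
    (hle : ∀ n, ∫⁻ x, ‖u n x‖ₑ ^ 2 ∂m ≤ ∫⁻ x, ‖v x‖ₑ ^ 2 ∂m)
    (hfin : ∫⁻ x, ‖v x‖ₑ ^ 2 ∂m ≠ ∞) :
    Tendsto (fun n => ∫⁻ x, ‖u n x - v x‖ₑ ^ 2 ∂m) atTop (𝓝 0) := by
  set A := ∫⁻ x, ‖v x‖ₑ ^ 2 ∂m with hA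
  have h4 : 4 * A ≠ ∞ := ENNReal.mul_ne_top (by simp) hfin
  have hsum : ∀ n, ∫⁻ x, ‖u n x + v x‖ₑ ^ 2 ∂m + ∫⁻ x, ‖u n x - v x‖ₑ ^ 2 ∂m ≤ 4 * A := by
    intro n
    have := hu n
    rw [← lintegral_add_left (by fun_prop)]
    simp_rw [enorm_parallelogram]
    rw [lintegral_add_left (by fun_prop), lintegral_const_mul _ (by fun_prop),
      lintegral_const_mul _ (by fun_prop)]
    calc _ ≤ 2 * A + 2 * A := by gcongr; exact hle n
      _ = 4 * A := by ring
  have hfatou : 4 * A ≤ liminf (fun n => ∫⁻ x, ‖u n x + v x‖ₑ ^ 2 ∂m) atTop := by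
    refine le_trans (le_of_eq ?_) (lintegral_liminf_le (fun n => by have := hu n; fun_prop))
    rw [hA, ← lintegral_const_mul _ (by fun_prop)]
    refine lintegral_congr_ae (hlim.mono fun x hx => ?_)
    have : Tendsto (fun n => ‖u n x + v x‖ₑ ^ 2) atTop (𝓝 (‖v x + v x‖ₑ ^ 2)) :=
      ((ENNReal.continuous_pow 2).tendsto _).comp
        ((continuous_enorm.tendsto _).comp (hx.add_const _))
    simp only
    rw [this.liminf_eq, ← two_mul, enorm_mul, mul_pow]
    congr 1
    rw [← ofReal_norm]
    norm_num
  rw [ENNReal.tendsto_nhds_zero]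
  intro ε hε
  rcases eq_or_ne ε ∞ with rfl | hε'
  · simp
  by_cases hA0 : 4 * A = 0
  · refine Eventually.of_forall fun n => ?_
    exact (le_add_self.trans (hsum n)).trans (by rw [hA0]; exact zero_le)
  have hlt : 4 * A - ε < liminf (fun n => ∫⁻ x, ‖u n x + v x‖ₑ ^ 2 ∂m) atTop :=
    lt_of_lt_of_le (ENNReal.sub_lt_self h4 hA0 hε.ne') hfatou
  filter_upwards [eventually_lt_of_lt_liminf hlt] with n hn
  have h1 := hsum n
  have ha : ∫⁻ x, ‖u n x + v x‖ₑ ^ 2 ∂m ≠ ∞ := ne_top_of_le_ne_top h4 (le_self_add.trans h1)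
  have h2 : 4 * A ≤ ∫⁻ x, ‖u n x + v x‖ₑ ^ 2 ∂m + ε := tsub_le_iff_right.mp hn.le
  exact (ENNReal.add_le_add_iff_left ha).mp (h1.trans h2)

/-- A sequence of radii increasing to `1`. -/
def radius (n : ℕ) : ℝ := 1 - 1 / ((n : ℝ) + 2)

lemma radius_pos (n : ℕ) : 0 < radius n := by
  unfold radius
  rw [sub_pos, div_lt_one (by positivity)]
  have : (0 : ℝ) ≤ n := by positivity
  linarith

lemma radius_lt_one (n : ℕ) : radius n < 1 := by
  unfold radius
  have : (0 : ℝ) < 1 / ((n : ℝ) + 2) := by positivity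
  linarith

lemma tendsto_radius : Tendsto radius atTop (𝓝 1) := by
  have h : Tendsto (fun n : ℕ => 1 / ((n : ℝ) + 2)) atTop (𝓝 0) := by
    have := (tendsto_add_atTop_iff_nat 1).mpr (tendsto_one_div_add_atTop_nhds_zero_nat (𝕜 := ℝ))
    refine this.congr fun n => ?_
    push_cast
    ring
  have := h.const_sub 1
  rw [sub_zero] at this
  exact this

lemma radius_mul_mem_disc (n : ℕ) {z : ℂ} (hz : z ∈ disc) : (radius n : ℂ) * z ∈ disc := by
  rw [mem_disc] at hz ⊢
  rw [norm_mul, Complex.norm_real, Real.norm_eq_abs, abs_of_pos (radius_pos n)]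
  exact lt_of_le_of_lt (mul_le_of_le_one_left (norm_nonneg _) (radius_lt_one n).le) hz

lemma tendsto_comp_radius {g : ℂ → ℂ} (hg : ContinuousOn g disc) {z : ℂ} (hz : z ∈ disc) :
    Tendsto (fun n => g (radius n * z)) atTop (𝓝 (g z)) := by
  have h1 : Tendsto (fun n => (radius n : ℂ) * z) atTop (𝓝 z) := by
    have := ((continuous_ofReal.tendsto 1).comp tendsto_radius).mul_const z
    simpa using this
  exact ((hg.continuousAt (isOpen_disc.mem_nhds hz)).tendsto).comp h1

lemma differentiableOn_comp_mul {F : ℂ → ℂ} (hF : DifferentiableOn ℂ F disc) (n : ℕ) :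
    DifferentiableOn ℂ (fun z => F (radius n * z)) disc :=
  hF.comp (by fun_prop) (fun _ hz => radius_mul_mem_disc n hz)

lemma differentiableAt_of_mem {F : ℂ → ℂ} (hF : DifferentiableOn ℂ F disc) {z : ℂ}
    (hz : z ∈ disc) : DifferentiableAt ℂ F z := hF.differentiableAt (isOpen_disc.mem_nhds hz)

lemma tendsto_energy_dilation (ν : Measure ℂ) [SFinite ν] (hν : ∀ᵐ ζ ∂ν, ‖ζ‖ ≤ 1) {F : ℂ → ℂ}
    (hF : DifferentiableOn ℂ F disc) (hfin : energy ν F ≠ ∞) :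
    Tendsto (fun n => energy ν (fun z => F (radius n * z) - F z)) atTop (𝓝 0) := by
  have h := tendsto_lintegral_sub_sq (m := discMeasure ν)
    (u := fun n => deriv (fun z => F (radius n * z))) (v := deriv F)
    (fun n => measurable_deriv _) (measurable_deriv _) ?_
    (fun n => energy_dilation_le ν hν hF (radius_pos n).le (radius_lt_one n).le) hfin
  · refine h.congr fun n => lintegral_congr_ae ((ae_mem_disc ν).mono fun z hz => ?_)
    simp only
    rw [deriv_fun_sub (differentiableAt_of_mem (differentiableOn_comp_mul hF n) hz)
      (differentiableAt_of_mem hF hz)]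
  · refine (ae_mem_disc ν).mono fun z hz => ?_
    simp_rw [deriv_comp_mul_left, smul_eq_mul]
    have h1 := (continuous_ofReal.tendsto 1).comp tendsto_radius
    have := h1.mul (tendsto_comp_radius (differentiableOn_deriv hF).continuousOn hz)
    simpa using this

lemma deriv_eqOn_disc {F G : ℂ → ℂ} (h : EqOn F G disc) : EqOn (deriv F) (deriv G) disc :=
  fun _ hz => (h.eventuallyEq_of_mem (isOpen_disc.mem_nhds hz)).deriv_eq

lemma energy_congr (ν : Measure ℂ) {F G : ℂ → ℂ} (h : EqOn F G disc) :
    energy ν F = energy ν G :=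
  lintegral_congr_ae ((ae_mem_disc ν).mono fun z hz => by simp only [deriv_eqOn_disc h hz])

lemma energy_neg (ν : Measure ℂ) (F : ℂ → ℂ) : energy ν (fun z => -F z) = energy ν F := by
  simp [energy]

lemma energy_sub_const (ν : Measure ℂ) (F : ℂ → ℂ) (c : ℂ) :
    energy ν (fun z => F z - c) = energy ν F := by
  simp [energy]

lemma energy_add_le (ν : Measure ℂ) {F G : ℂ → ℂ} (hF : DifferentiableOn ℂ F disc)
    (hG : DifferentiableOn ℂ G disc) :
    energy ν (fun z => F z + G z) ≤ 2 * energy ν F + 2 * energy ν G := by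
  have hFm := measurable_energy_integrand F
  have hGm := measurable_energy_integrand G
  simp only [energy]
  rw [← lintegral_const_mul _ hFm, ← lintegral_const_mul _ hGm,
    ← lintegral_add_left (hFm.const_mul 2)]
  refine lintegral_mono_ae ((ae_mem_disc ν).mono fun z hz => ?_)
  rw [deriv_fun_add (differentiableAt_of_mem hF hz) (differentiableAt_of_mem hG hz)]
  exact enorm_add_sq_le _ _

lemma energy_le_of_norm_deriv_le (ν : Measure ℂ) {F : ℂ → ℂ} {C : ℝ}
    (h : ∀ z ∈ disc, ‖deriv F z‖ ≤ C) :
    energy ν F ≤ ENNReal.ofReal C ^ 2 * discMeasure ν univ := by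
  rw [energy, ← lintegral_const]
  refine lintegral_mono_ae ((ae_mem_disc ν).mono fun z hz => ?_)
  gcongr
  rw [← ofReal_norm]
  exact ENNReal.ofReal_le_ofReal (h z hz)

lemma enorm_le_ofReal {w : ℂ} {C : ℝ} (h : ‖w‖ ≤ C) : ‖w‖ₑ ≤ ENNReal.ofReal C := by
  rw [← ofReal_norm]
  exact ENNReal.ofReal_le_ofReal h

lemma energy_mul_le (ν : Measure ℂ) {a b : ℂ → ℂ} (ha : DifferentiableOn ℂ a disc)
    (hb : DifferentiableOn ℂ b disc) {B : ℝ} (hB : ∀ z ∈ disc, ‖b z‖ ≤ B) :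
    energy ν (fun z => a z * b z) ≤ 2 * ENNReal.ofReal B ^ 2 * energy ν a +
      2 * ∫⁻ z, ‖a z‖ₑ ^ 2 * ‖deriv b z‖ₑ ^ 2 ∂(discMeasure ν) := by
  have hac : AEMeasurable (fun z => ‖a z‖ₑ ^ 2 * ‖deriv b z‖ₑ ^ 2) (discMeasure ν) :=
    ((aemeasurable_discMeasure ν ha.continuousOn).enorm.pow_const 2).mul
      (measurable_energy_integrand b).aemeasurable
  have ham := measurable_energy_integrand a
  simp only [energy]
  rw [← lintegral_const_mul _ ham, ← lintegral_const_mul'' _ hac,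
    ← lintegral_add_left (ham.const_mul _)]
  refine lintegral_mono_ae ((ae_mem_disc ν).mono fun z hz => ?_)
  rw [deriv_fun_mul (differentiableAt_of_mem ha hz) (differentiableAt_of_mem hb hz)]
  refine (enorm_add_sq_le _ _).trans ?_
  rw [enorm_mul, enorm_mul, mul_pow, mul_pow]
  have := enorm_le_ofReal (hB z hz)
  calc _ ≤ 2 * (‖deriv a z‖ₑ ^ 2 * ENNReal.ofReal B ^ 2) + 2 * (‖a z‖ₑ ^ 2 * ‖deriv b z‖ₑ ^ 2) := by
        gcongr
    _ = _ := by ring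

lemma energy_mul_ne_top (ν : Measure ℂ) {a b : ℂ → ℂ} (ha : DifferentiableOn ℂ a disc)
    (hb : DifferentiableOn ℂ b disc) {A B : ℝ} (hA : ∀ z ∈ disc, ‖a z‖ ≤ A)
    (hB : ∀ z ∈ disc, ‖b z‖ ≤ B) (hae : energy ν a ≠ ∞) (hbe : energy ν b ≠ ∞) :
    energy ν (fun z => a z * b z) ≠ ∞ := by
  have h : ∫⁻ z, ‖a z‖ₑ ^ 2 * ‖deriv b z‖ₑ ^ 2 ∂(discMeasure ν) ≤
      ENNReal.ofReal A ^ 2 * energy ν b := by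
    rw [energy, ← lintegral_const_mul _ (measurable_energy_integrand b)]
    refine lintegral_mono_ae ((ae_mem_disc ν).mono fun z hz => ?_)
    have := enorm_le_ofReal (hA z hz)
    gcongr
  refine ne_top_of_le_ne_top ?_ (energy_mul_le ν ha hb hB)
  have h2 := ne_top_of_le_ne_top (ENNReal.mul_ne_top (by simp) hbe) h
  exact ENNReal.add_ne_top.mpr ⟨ENNReal.mul_ne_top (ENNReal.mul_ne_top (by simp) (by simp)) hae,
    ENNReal.mul_ne_top (by simp) h2⟩

/-- Multiplication by a bounded function of finite energy is continuous along boundedly pointwise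
null sequences. -/
lemma tendsto_energy_mul (ν : Measure ℂ) {a : ℕ → ℂ → ℂ} {b : ℂ → ℂ}
    (ha : ∀ n, DifferentiableOn ℂ (a n) disc) (hb : DifferentiableOn ℂ b disc) {A B : ℝ}
    (hA : ∀ n, ∀ z ∈ disc, ‖a n z‖ ≤ A) (hB : ∀ z ∈ disc, ‖b z‖ ≤ B)
    (hlim : ∀ z ∈ disc, Tendsto (fun n => a n z) atTop (𝓝 0))
    (hae : Tendsto (fun n => energy ν (a n)) atTop (𝓝 0)) (hbe : energy ν b ≠ ∞) :
    Tendsto (fun n => energy ν (fun z => a n z * b z)) atTop (𝓝 0) := by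
  have h : Tendsto (fun n => ∫⁻ z, ‖a n z‖ₑ ^ 2 * ‖deriv b z‖ₑ ^ 2 ∂(discMeasure ν)) atTop
      (𝓝 (∫⁻ _, 0 ∂(discMeasure ν))) := by
    refine tendsto_lintegral_of_dominated_convergence'
      (fun z => ENNReal.ofReal A ^ 2 * ‖deriv b z‖ₑ ^ 2) (fun n => ?_) (fun n => ?_) ?_ ?_
    · exact ((aemeasurable_discMeasure ν (ha n).continuousOn).enorm.pow_const 2).mul
        (measurable_energy_integrand b).aemeasurable
    · refine (ae_mem_disc ν).mono fun z hz => ?_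
      have := enorm_le_ofReal (hA n z hz)
      dsimp only
      gcongr
    · rw [lintegral_const_mul _ (measurable_energy_integrand b)]
      exact ENNReal.mul_ne_top (by simp) hbe
    · refine (ae_mem_disc ν).mono fun z hz => ?_
      have h1 : Tendsto (fun n => ‖a n z‖ₑ ^ 2) atTop (𝓝 0) := by
        simpa [Function.comp_def] using ((ENNReal.continuous_pow 2).tendsto _).comp
          ((continuous_enorm.tendsto _).comp (hlim z hz))
      have := ENNReal.Tendsto.mul_const (b := ‖deriv b z‖ₑ ^ 2) h1 (Or.inr (by simp))
      rwa [zero_mul] at this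
  rw [lintegral_zero] at h
  refine tendsto_of_tendsto_of_tendsto_of_le_of_le tendsto_const_nhds ?_ (fun _ => zero_le)
    (fun n => energy_mul_le ν (ha n) hb hB)
  have h1 := ENNReal.Tendsto.const_mul (a := 2 * ENNReal.ofReal B ^ 2) hae
    (Or.inr (ENNReal.mul_ne_top (by simp) (by simp)))
  have h2 := ENNReal.Tendsto.const_mul (a := 2) h (Or.inr (by simp))
  simpa using h1.add h2

lemma HasPowerSeriesOnDisc.tendstoUniformlyOn {c : ℕ → ℂ} {k : ℂ → ℂ}
    (h : HasPowerSeriesOnDisc c k) {r : ℝ} (h0 : 0 ≤ r) (h1 : r < 1) :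
    TendstoUniformlyOn (fun N z => ∑ n ∈ Finset.range N, c n * (r : ℂ) ^ n * z ^ n)
      (fun z => k (r * z)) atTop disc := by
  have := tendstoUniformlyOn_tsum_nat (s := disc) (f := fun n z => c n * (r : ℂ) ^ n * z ^ n)
    (h.summable_norm h0 h1) fun n z hz => by
      rw [norm_mul, norm_mul, norm_pow, norm_pow, Complex.norm_real, Real.norm_of_nonneg h0]
      exact mul_le_of_le_one_right (by positivity)
        (pow_le_one₀ (norm_nonneg _) (mem_disc.mp hz).le)
  refine this.congr_right fun z hz => ?_
  have hz' : (r : ℂ) * z ∈ disc := by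
    rw [mem_disc] at hz ⊢
    rw [norm_mul, Complex.norm_real, Real.norm_of_nonneg h0]
    exact lt_of_le_of_lt (mul_le_of_le_one_left (norm_nonneg _) h1.le) hz
  rw [← (h _ hz').tsum_eq]
  simp_rw [mul_pow, mul_assoc]

lemma exists_polynomial_near_dilation {F : ℂ → ℂ} (hF : DifferentiableOn ℂ F disc) {r : ℝ}
    (h0 : 0 ≤ r) (h1 : r < 1) {ε : ℝ} (hε : 0 < ε) :
    ∃ q : Polynomial ℂ, ∀ z ∈ disc, ‖F (r * z) - q.eval z‖ ≤ ε ∧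
      ‖deriv (fun z => F (r * z) - q.eval z) z‖ ≤ ε := by
  have hs := hasPowerSeriesOnDisc_taylorCoeff hF
  have hs' := hasPowerSeriesOnDisc_taylorCoeff (differentiableOn_deriv hF)
  have e1 := (tendsto_add_atTop_nat 1).eventually
    (Metric.tendstoUniformlyOn_iff.mp (hs.tendstoUniformlyOn h0 h1) ε hε)
  have e2 := Metric.tendstoUniformlyOn_iff.mp (hs'.tendstoUniformlyOn h0 h1) ε hε
  obtain ⟨N, hN1, hN2⟩ := (e1.and e2).exists
  refine ⟨∑ n ∈ Finset.range (N + 1), Polynomial.C (taylorCoeff F n * (r : ℂ) ^ n) *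
    Polynomial.X ^ n, fun z hz => ⟨?_, ?_⟩⟩
  · have := hN1 z hz
    rw [dist_eq_norm] at this
    simpa [Polynomial.eval_finsetSum] using this.le
  · have := (hN2 z hz).le
    rw [dist_eq_norm] at this
    have hz' : (r : ℂ) * z ∈ disc := by
      rw [mem_disc] at hz ⊢
      rw [norm_mul, Complex.norm_real, Real.norm_of_nonneg h0]
      exact lt_of_le_of_lt (mul_le_of_le_one_left (norm_nonneg _) h1.le) hz
    have hd : DifferentiableAt ℂ (fun z => F (r * z)) z :=
      (differentiableAt_of_mem hF hz').comp z (by fun_prop)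
    rw [deriv_fun_sub hd (Polynomial.differentiableAt _), deriv_comp_mul_left, Polynomial.deriv,
      smul_eq_mul]
    have key : Polynomial.eval z (Polynomial.derivative (∑ n ∈ Finset.range (N + 1),
        Polynomial.C (taylorCoeff F n * (r : ℂ) ^ n) * Polynomial.X ^ n)) =
        r * ∑ n ∈ Finset.range N, taylorCoeff (deriv F) n * (r : ℂ) ^ n * z ^ n := by
      rw [Finset.sum_range_succ', Polynomial.derivative_add, Polynomial.derivative_sum,
        Polynomial.eval_add, Polynomial.eval_finsetSum, Finset.mul_sum]
      simp only [Polynomial.derivative_C_mul_X_pow, Polynomial.eval_mul, Polynomial.eval_C,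
        Polynomial.eval_pow, Polynomial.eval_X, taylorCoeff_deriv]
      rw [Nat.cast_zero, mul_zero, zero_mul, add_zero]
      refine Finset.sum_congr rfl fun n _ => ?_
      rw [Nat.add_sub_cancel]
      push_cast
      ring
    rw [key, ← mul_sub, norm_mul, Complex.norm_real, Real.norm_of_nonneg h0]
    exact (mul_le_of_le_one_left (norm_nonneg _) h1.le).trans this

/-- Polynomials are dense among functions of finite energy. -/
lemma exists_polynomial_approx (ν : Measure ℂ) [IsFiniteMeasure ν] (hν : ∀ᵐ ζ ∂ν, ‖ζ‖ ≤ 1)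
    {F : ℂ → ℂ} (hF : DifferentiableOn ℂ F disc) (hfin : energy ν F ≠ ∞) :
    ∃ q : ℕ → Polynomial ℂ,
      Tendsto (fun n => energy ν (fun z => F z - (q n).eval z)) atTop (𝓝 0) ∧
      (∀ z ∈ disc, Tendsto (fun n => F z - (q n).eval z) atTop (𝓝 0)) ∧
      ∀ M, (∀ z ∈ disc, ‖F z‖ ≤ M) → ∀ n, ∀ z ∈ disc, ‖(q n).eval z‖ ≤ M + 1 := by
  have hpos : ∀ n : ℕ, (0 : ℝ) < 1 / ((n : ℝ) + 1) := fun n => by positivity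
  choose q hq using fun n =>
    exists_polynomial_near_dilation hF (radius_pos n).le (radius_lt_one n) (hpos n)
  have h0 := tendsto_one_div_add_atTop_nhds_zero_nat (𝕜 := ℝ)
  refine ⟨q, ?_, fun z hz => ?_, fun M hM n z hz => ?_⟩
  · have := isFiniteMeasure_discMeasure ν hν
    refine tendsto_of_tendsto_of_tendsto_of_le_of_le (g := fun _ => 0)
      (h := fun n : ℕ => 2 * energy ν (fun z => F (radius n * z) - F z) +
        2 * (ENNReal.ofReal (1 / ((n : ℝ) + 1)) ^ 2 * discMeasure ν univ))
      tendsto_const_nhds ?_ (fun _ => zero_le) (fun n => ?_)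
    · have h1 := ENNReal.Tendsto.const_mul (a := 2) (tendsto_energy_dilation ν hν hF hfin)
        (Or.inr (by simp))
      have h2 : Tendsto (fun n : ℕ => ENNReal.ofReal (1 / ((n : ℝ) + 1)) ^ 2) atTop (𝓝 0) := by
        simpa [Function.comp_def] using
          ((ENNReal.continuous_pow 2).tendsto _).comp (ENNReal.tendsto_ofReal h0)
      have h3 := ENNReal.Tendsto.const_mul (a := 2) (ENNReal.Tendsto.mul_const
        (b := discMeasure ν univ) h2 (Or.inr (measure_ne_top _ _))) (Or.inr (by simp))
      simpa using h1.add h3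
    · have hd := differentiableOn_comp_mul hF n
      have hqd : DifferentiableOn ℂ (fun z => (q n).eval z) disc :=
        (Polynomial.differentiable _).differentiableOn
      have e := energy_add_le ν (hd.fun_sub hF).fun_neg (hd.fun_sub hqd)
      rw [energy_neg] at e
      refine le_trans (le_of_eq (energy_congr ν fun z _ => ?_)) (e.trans ?_)
      · ring
      · exact add_le_add_right (mul_le_mul_right (energy_le_of_norm_deriv_le ν
          fun z hz => (hq n z hz).2) 2) _
  · have h1 : Tendsto (fun n => F (radius n * z) - (q n).eval z) atTop (𝓝 0) :=
      squeeze_zero_norm (fun n => (hq n z hz).1) h0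
    have h2 := h1.sub ((tendsto_comp_radius hF.continuousOn hz).sub_const (F z))
    simpa using h2
  · have h1 := (hq n z hz).1
    have h2 : 1 / ((n : ℝ) + 1) ≤ 1 := by
      rw [div_le_one (by positivity)]
      have : (0 : ℝ) ≤ n := by positivity
      linarith
    have h3 := hM _ (radius_mul_mem_disc n hz)
    have h4 := norm_sub_norm_le ((q n).eval z) (F (radius n * z))
    rw [norm_sub_rev] at h4
    linarith

lemma energy_add_measure (ν ν' : Measure ℂ) [SFinite ν] [SFinite ν'] (F : ℂ → ℂ) :
    energy (ν + ν') F = energy ν F + energy ν' F := by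
  simp only [energy]
  rw [lintegral_discMeasure _ (measurable_energy_integrand F),
    lintegral_discMeasure _ (measurable_energy_integrand F),
    lintegral_discMeasure _ (measurable_energy_integrand F), lintegral_add_measure]

lemma poissonWeight_zero (z : ℂ) : poissonWeight 0 z = ENNReal.ofReal (1 - ‖z‖ ^ 2) := by
  simp [poissonWeight]

lemma energy_dirac_zero {F : ℂ → ℂ} (hF : DifferentiableOn ℂ F disc) :
    energy (Measure.dirac 0) F =
      ∑' n : ℕ, ENNReal.ofReal (Real.pi * (n + 1) / (n + 2) * ‖taylorCoeff F (n + 1)‖ ^ 2) := by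
  have hd := differentiableOn_deriv hF
  rw [energy, lintegral_discMeasure' _ (measurable_energy_integrand F)]
  have : ∀ z, weight (Measure.dirac 0) z = ENNReal.ofReal (1 - ‖z‖ ^ 2) := fun z => by
    rw [weight, lintegral_dirac, poissonWeight_zero]
  simp_rw [this]
  rw [(hasPowerSeriesOnDisc_taylorCoeff hd).lintegral_disc hd.continuousOn]
  refine tsum_congr fun n => ?_
  rw [taylorCoeff_deriv, ← ofReal_norm, ← ENNReal.ofReal_pow (norm_nonneg _),
    ← ENNReal.ofReal_mul (by positivity)]
  congr 1
  rw [norm_mul, show (n : ℂ) + 1 = ((n + 1 : ℕ) : ℂ) by push_cast; rfl, Complex.norm_natCast]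
  push_cast
  field_simp

lemma ofReal_le_of_mem_hardySet {F : ℂ → ℂ} (hF : DifferentiableOn ℂ F disc) {x : ℝ}
    (hx : x ∈ hardySet F) :
    ENNReal.ofReal x ≤ ENNReal.ofReal (‖F 0‖ ^ 2) + energy (Measure.dirac 0) F := by
  obtain ⟨r, h0, h1, rfl⟩ := hx
  have hs := (hasPowerSeriesOnDisc_taylorCoeff hF).hasSum_norm_sq h0.le h1
  rw [one_div, ← hs.tsum_eq, ENNReal.ofReal_tsum_of_nonneg (fun n => by positivity) hs.summable,
    tsum_eq_zero_add' ENNReal.summable, energy_dirac_zero hF]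
  refine add_le_add (by rw [taylorCoeff_zero, mul_zero, pow_zero, mul_one])
    (ENNReal.tsum_le_tsum fun n => ?_)
  refine ENNReal.ofReal_le_ofReal ?_
  have h2 : r ^ (2 * (n + 1)) ≤ 1 := pow_le_one₀ h0.le h1.le
  have h3 : 1 ≤ Real.pi * (n + 1) / (n + 2) := by
    rw [one_le_div (by positivity)]
    have := Real.pi_gt_three
    have : (0 : ℝ) ≤ n := by positivity
    nlinarith
  calc _ ≤ ‖taylorCoeff F (n + 1)‖ ^ 2 := mul_le_of_le_one_right (by positivity) h2
    _ ≤ _ := le_mul_of_one_le_left (by positivity) h3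

lemma hardyNormSq_le {F : ℂ → ℂ} (hF : DifferentiableOn ℂ F disc)
    (hfin : energy (Measure.dirac 0) F ≠ ∞) :
    hardyNormSq F ≤ ‖F 0‖ ^ 2 + (energy (Measure.dirac 0) F).toReal := by
  refine Real.sSup_le (fun x hx => ?_) (by positivity)
  have := ofReal_le_of_mem_hardySet hF hx
  rw [← ENNReal.ofReal_toReal hfin, ← ENNReal.ofReal_add (by positivity) (by positivity)] at this
  exact (ENNReal.ofReal_le_ofReal_iff (by positivity)).mp this

lemma energy_dirac_zero_le {F : ℂ → ℂ} (hF : DifferentiableOn ℂ F disc) {M : ℝ}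
    (hM : ∀ x ∈ hardySet F, x ≤ M) :
    energy (Measure.dirac 0) F ≤ ENNReal.ofReal (4 * (M - ‖F 0‖ ^ 2)) := by
  have hsum : ∀ N, ∑ n ∈ Finset.range N, ‖taylorCoeff F n‖ ^ 2 ≤ M := by
    intro N
    have ht : Tendsto (fun k => ∑ n ∈ Finset.range N, ‖taylorCoeff F n‖ ^ 2 *
        radius k ^ (2 * n)) atTop (𝓝 (∑ n ∈ Finset.range N, ‖taylorCoeff F n‖ ^ 2 *
          1 ^ (2 * n))) :=
      tendsto_finsetSum _ fun n _ => (tendsto_radius.pow _).const_mul _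
    simp only [one_pow, mul_one] at ht
    refine le_of_tendsto' ht fun k => ?_
    have hs := (hasPowerSeriesOnDisc_taylorCoeff hF).hasSum_norm_sq (radius_pos k).le
      (radius_lt_one k)
    refine (sum_le_hasSum _ (fun n _ => ?_) hs).trans
      (hM _ ⟨radius k, radius_pos k, radius_lt_one k, by rw [one_div]⟩)
    have := radius_pos k
    positivity
  rw [energy_dirac_zero hF]
  refine ENNReal.tsum_le_of_sum_range_le fun N => ?_
  rw [← ENNReal.ofReal_sum_of_nonneg (fun n _ => by positivity)]
  refine ENNReal.ofReal_le_ofReal ?_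
  have h := hsum (N + 1)
  rw [Finset.sum_range_succ', taylorCoeff_zero] at h
  calc _ ≤ ∑ n ∈ Finset.range N, 4 * ‖taylorCoeff F (n + 1)‖ ^ 2 := by
        refine Finset.sum_le_sum fun n _ => mul_le_mul_of_nonneg_right ?_ (by positivity)
        rw [div_le_iff₀ (by positivity)]
        have := Real.pi_lt_four
        have : (0 : ℝ) ≤ n := by positivity
        nlinarith
    _ = 4 * ∑ n ∈ Finset.range N, ‖taylorCoeff F (n + 1)‖ ^ 2 := by rw [Finset.mul_sum]
    _ ≤ _ := by linarith

lemma hardySet_le_of_norm_le {F : ℂ → ℂ} (hF : DifferentiableOn ℂ F disc) {M : ℝ}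
    (hM : ∀ z ∈ disc, ‖F z‖ ≤ M) {x : ℝ} (hx : x ∈ hardySet F) : x ≤ M ^ 2 := by
  obtain ⟨r, h0, h1, rfl⟩ := hx
  have hmem : ∀ t, (r : ℂ) * bpt t ∈ disc := fun t => smul_bpt_mem_disc h0.le h1 t
  have hc : Continuous fun t => ‖F (r * bpt t)‖ ^ 2 :=
    ((hF.continuousOn.comp_continuous (continuous_const.mul continuous_bpt) hmem).norm).pow 2
  have : ∫ t in (0:ℝ)..(2 * Real.pi), ‖F (r * bpt t)‖ ^ 2 ≤
      ∫ t in (0:ℝ)..(2 * Real.pi), M ^ 2 := by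
    refine intervalIntegral.integral_mono_on (by positivity) (hc.intervalIntegrable _ _)
      (by simp) fun t _ => ?_
    exact pow_le_pow_left₀ (norm_nonneg _) (hM _ (hmem t)) 2
  rw [intervalIntegral.integral_const, sub_zero, smul_eq_mul] at this
  calc _ ≤ 1 / (2 * Real.pi) * (2 * Real.pi * M ^ 2) := by gcongr
    _ = M ^ 2 := by field_simp

lemma kernel_nonneg {z : ℂ} (hz : z ∈ disc) (ζ : ℂ) :
    0 ≤ (1 - ‖z‖ ^ 2) / ‖1 - (starRingEnd ℂ) ζ * z‖ ^ 2 := by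
  have := mem_disc.mp hz
  have : 0 ≤ 1 - ‖z‖ ^ 2 := by nlinarith [norm_nonneg z]
  positivity

lemma enorm_kernel {z : ℂ} (hz : z ∈ disc) (ζ : ℂ) :
    ‖(1 - ‖z‖ ^ 2) / ‖1 - (starRingEnd ℂ) ζ * z‖ ^ 2‖ₑ = poissonWeight ζ z := by
  rw [poissonWeight, Real.enorm_eq_ofReal (kernel_nonneg hz ζ)]

lemma enorm_poissonMu_le (μ : Measure ℂ) {z : ℂ} (hz : z ∈ disc) :
    ‖poissonMu μ z‖ₑ ≤ weight μ z := by
  refine (enorm_integral_le_lintegral_enorm _).trans (le_of_eq ?_)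
  simp_rw [enorm_kernel hz]
  rfl

lemma poissonWeight_le {z ζ : ℂ} (hz : z ∈ disc) (hζ : ‖ζ‖ ≤ 1) :
    poissonWeight ζ z ≤ ENNReal.ofReal (1 / (1 - ‖z‖) ^ 2) := by
  have h1 := mem_disc.mp hz
  have h2 : 1 - ‖z‖ ≤ ‖1 - (starRingEnd ℂ) ζ * z‖ := by
    have := norm_sub_norm_le 1 ((starRingEnd ℂ) ζ * z)
    rw [norm_one, norm_mul, RCLike.norm_conj] at this
    nlinarith [norm_nonneg z]
  refine ENNReal.ofReal_le_ofReal ?_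
  have h3 : 0 < 1 - ‖z‖ := by linarith
  gcongr
  nlinarith [norm_nonneg z]

lemma enorm_poissonMu (μ : Measure ℂ) [IsFiniteMeasure μ] (hμ : ∀ᵐ ζ ∂μ, ‖ζ‖ ≤ 1) {z : ℂ}
    (hz : z ∈ disc) : ‖poissonMu μ z‖ₑ = weight μ z := by
  have hm : Measurable fun ζ : ℂ => (1 - ‖z‖ ^ 2) / ‖1 - (starRingEnd ℂ) ζ * z‖ ^ 2 := by
    have := Complex.continuous_conj.measurable
    fun_prop
  have hPint : Integrable (fun ζ : ℂ => (1 - ‖z‖ ^ 2) / ‖1 - (starRingEnd ℂ) ζ * z‖ ^ 2) μ := by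
    refine ⟨hm.aestronglyMeasurable, ?_⟩
    rw [HasFiniteIntegral]
    simp_rw [enorm_kernel hz]
    refine (lintegral_mono_ae (hμ.mono fun ζ hζ => poissonWeight_le hz hζ)).trans_lt ?_
    rw [lintegral_const]
    exact ENNReal.mul_lt_top ENNReal.ofReal_lt_top (measure_lt_top _ _)
  rw [poissonMu, Real.enorm_eq_ofReal (integral_nonneg (kernel_nonneg hz)),
    ofReal_integral_eq_lintegral_ofReal hPint (Eventually.of_forall (kernel_nonneg hz))]
  rfl

lemma energy_ne_top_of_integrableOn (μ : Measure ℂ) [IsFiniteMeasure μ]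
    (hμ : ∀ᵐ ζ ∂μ, ‖ζ‖ ≤ 1) {F : ℂ → ℂ} (h : IntegrableOn (dirichletDensity μ F) disc) :
    energy μ F ≠ ∞ := by
  rw [energy, lintegral_discMeasure' _ (measurable_energy_integrand F)]
  refine ne_of_lt (lt_of_le_of_lt (le_of_eq ?_) h.2)
  refine setLIntegral_congr_fun isOpen_disc.measurableSet fun z hz => ?_
  simp only [dirichletDensity]
  rw [enorm_mul, enorm_poissonMu μ hμ hz, enorm_pow, enorm_norm]

lemma energy_ne_top_of_memD (μ : Measure ℂ) [IsFiniteMeasure μ] (hμ : ∀ᵐ ζ ∂μ, ‖ζ‖ ≤ 1)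
    {F : ℂ → ℂ} (h : MemD μ F) : energy (μ + Measure.dirac 0) F ≠ ∞ := by
  obtain ⟨⟨hF, M, hM⟩, hPint⟩ := h
  rw [energy_add_measure]
  exact ENNReal.add_ne_top.mpr ⟨energy_ne_top_of_integrableOn μ hμ hPint,
    ne_top_of_le_ne_top ENNReal.ofReal_ne_top (energy_dirac_zero_le hF fun x hx => hM hx)⟩

lemma dirichletIntegral_le (μ : Measure ℂ) [SFinite μ] {F : ℂ → ℂ} (hfin : energy μ F ≠ ∞) :
    dirichletIntegral μ F ≤ (energy μ F).toReal := by
  have h : ‖∫ z in disc, dirichletDensity μ F z‖ₑ ≤ energy μ F := by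
    refine (enorm_integral_le_lintegral_enorm _).trans ?_
    rw [energy, lintegral_discMeasure' _ (measurable_energy_integrand F)]
    refine setLIntegral_mono' isOpen_disc.measurableSet fun z hz => ?_
    rw [dirichletDensity, enorm_mul, enorm_pow, enorm_norm]
    gcongr
    exact enorm_poissonMu_le μ hz
  have h2 : |∫ z in disc, dirichletDensity μ F z| ≤ (energy μ F).toReal := by
    have := ENNReal.toReal_mono hfin h
    rwa [toReal_enorm, Real.norm_eq_abs] at this
  have h3 : 1 / Real.pi ≤ 1 := by
    rw [div_le_one Real.pi_pos]
    linarith [Real.pi_gt_three]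
  calc _ ≤ 1 / Real.pi * |∫ z in disc, dirichletDensity μ F z| :=
        mul_le_mul_of_nonneg_left (le_abs_self _) (by positivity)
    _ ≤ |∫ z in disc, dirichletDensity μ F z| := mul_le_of_le_one_left (abs_nonneg _) h3
    _ ≤ _ := h2

lemma dNormSq_le (μ : Measure ℂ) [SFinite μ] {F : ℂ → ℂ} (hF : DifferentiableOn ℂ F disc)
    (hfin : energy (μ + Measure.dirac 0) F ≠ ∞) :
    dNormSq μ F ≤ ‖F 0‖ ^ 2 + (energy (μ + Measure.dirac 0) F).toReal := by
  rw [energy_add_measure] at hfin ⊢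
  obtain ⟨h1, h2⟩ := ENNReal.add_ne_top.mp hfin
  rw [ENNReal.toReal_add h1 h2, dNormSq]
  linarith [hardyNormSq_le hF h2, dirichletIntegral_le μ h1]

lemma msupport_eq_support (μ : Measure ℂ) : msupport μ = μ.support := by
  ext x
  rw [Metric.nhds_basis_ball.mem_measureSupport]
  rfl

lemma measure_compl_msupport (μ : Measure ℂ) : μ (msupport μ)ᶜ = 0 := by
  rw [msupport_eq_support]
  exact Measure.measure_compl_support

lemma OnCircle.msupport_subset {μ : Measure ℂ} (hμ : OnCircle μ) : msupport μ ⊆ circleT := by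
  rw [msupport_eq_support]
  exact Measure.support_subset_of_isClosed Metric.isClosed_sphere (mem_ae_iff.mpr hμ)

lemma OnCircle.isCompact_msupport {μ : Measure ℂ} (hμ : OnCircle μ) : IsCompact (msupport μ) :=
  (isCompact_sphere 0 1).of_isClosed_subset
    (by rw [msupport_eq_support]; exact Measure.isClosed_support) hμ.msupport_subset

lemma OnCircle.ae_norm_eq_one {μ : Measure ℂ} (hμ : OnCircle μ) : ∀ᵐ ζ ∂μ, ‖ζ‖ = 1 :=
  (show ∀ᵐ ζ ∂μ, ζ ∈ circleT from mem_ae_iff.mpr hμ).mono fun _ h => mem_sphere_zero_iff_norm.mp h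

/-- Off `Zlow f`, the modulus of a bounded function is locally bounded below. -/
lemma eventually_lt_norm_of_notMem_Zlow {f : ℂ → ℂ} (hf : MemHinf f) {ζ : ℂ}
    (hζ : ζ ∈ closedBall (0 : ℂ) 1) (h : ζ ∉ Zlow f) :
    ∃ δ > 0, ∀ᶠ z in 𝓝[disc] ζ, δ < ‖f z‖ := by
  obtain ⟨-, C, hC⟩ := hf
  have : (𝓝[disc] ζ).NeBot := by
    rw [← mem_closure_iff_nhdsWithin_neBot, disc, closure_ball _ one_ne_zero]
    exact hζ
  have hb : IsBoundedUnder (· ≥ ·) (𝓝[disc] ζ) (fun z => ‖f z‖) :=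
    isBoundedUnder_of ⟨0, fun z => norm_nonneg _⟩
  have hb' : IsBoundedUnder (· ≤ ·) (𝓝[disc] ζ) (fun z => ‖f z‖) :=
    ⟨C, eventually_map.mpr (eventually_mem_nhdsWithin.mono hC)⟩
  have h0 : 0 ≤ liminf (fun z => ‖f z‖) (𝓝[disc] ζ) :=
    le_liminf_of_le hb'.isCoboundedUnder_ge (Eventually.of_forall fun z => norm_nonneg _)
  have hpos : 0 < liminf (fun z => ‖f z‖) (𝓝[disc] ζ) :=
    lt_of_le_of_ne h0 fun e => h ⟨hζ, e.symm⟩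
  exact ⟨_, half_pos hpos, eventually_lt_of_lt_liminf (half_lt_self hpos) hb⟩

lemma exists_lower_bound_near_compact {f : ℂ → ℂ} (hf : MemHinf f) {K : Set ℂ} (hK : IsCompact K)
    (hK1 : K ⊆ closedBall 0 1) (hd : Zlow f ∩ K = ∅) :
    ∃ δ > 0, ∃ η > 0, ∀ z ∈ disc, z ∈ thickening (2 * η) K → δ ≤ ‖f z‖ := by
  have key : ∃ δ > 0, ∃ U, IsOpen U ∧ K ⊆ U ∧ ∀ z ∈ disc, z ∈ U → δ ≤ ‖f z‖ := by
    refine hK.induction_on (p := fun s => ∃ δ > 0, ∃ U, IsOpen U ∧ s ⊆ U ∧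
      ∀ z ∈ disc, z ∈ U → δ ≤ ‖f z‖) ?_ ?_ ?_ ?_
    · exact ⟨1, one_pos, ∅, isOpen_empty, subset_rfl, fun _ _ h => h.elim⟩
    · rintro s t hst ⟨δ, hδ, U, hU, htU, h⟩
      exact ⟨δ, hδ, U, hU, hst.trans htU, h⟩
    · rintro s t ⟨δ, hδ, U, hU, hsU, h⟩ ⟨δ', hδ', U', hU', htU, h'⟩
      refine ⟨min δ δ', lt_min hδ hδ', U ∪ U', hU.union hU', union_subset_union hsU htU, ?_⟩
      rintro z hz (hzU | hzU)
      · exact (min_le_left _ _).trans (h z hz hzU)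
      · exact (min_le_right _ _).trans (h' z hz hzU)
    · intro ζ hζ
      obtain ⟨δ, hδ, h⟩ := eventually_lt_norm_of_notMem_Zlow hf (hK1 hζ)
        fun hZ => (hd ▸ ⟨hZ, hζ⟩ : ζ ∈ (∅ : Set ℂ))
      obtain ⟨U, hUm, hU, hζU⟩ := _root_.eventually_nhds_iff.mp (eventually_nhdsWithin_iff.mp h)
      exact ⟨U, mem_nhdsWithin_of_mem_nhds (hU.mem_nhds hζU), δ, hδ, U, hU, subset_rfl,
        fun z hz hzU => (hUm z hzU hz).le⟩
  obtain ⟨δ, hδ, U, hU, hKU, h⟩ := key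
  obtain ⟨η, hη, hηU⟩ := hK.exists_thickening_subset_open hU hKU
  exact ⟨δ, hδ, η / 2, half_pos hη, fun z hz hzt =>
    h z hz (hηU (by rwa [mul_div_cancel₀ _ two_ne_zero] at hzt))⟩

lemma norm_one_sub_conj_mul {ζ : ℂ} (hζ : ‖ζ‖ = 1) (z : ℂ) :
    ‖1 - (starRingEnd ℂ) ζ * z‖ = ‖ζ - z‖ := by
  have : ζ - z = ζ * (1 - (starRingEnd ℂ) ζ * z) := by
    have h : ζ * (starRingEnd ℂ) ζ = 1 := by
      rw [Complex.mul_conj, Complex.normSq_eq_norm_sq, hζ]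
      simp
    linear_combination z * h
  rw [this, norm_mul, hζ, one_mul]

lemma weight_le_of_notMem_thickening {μ : Measure ℂ} (hμ : OnCircle μ) {η : ℝ} (hη : 0 < η)
    {z : ℂ} (hz : z ∈ disc) (hzn : z ∉ thickening η (msupport μ)) :
    weight μ z ≤ ENNReal.ofReal (1 / η ^ 2) * μ univ * ENNReal.ofReal (1 - ‖z‖ ^ 2) := by
  have h1 : 0 ≤ 1 - ‖z‖ ^ 2 := by
    have := mem_disc.mp hz
    nlinarith [norm_nonneg z]
  have h : ∀ᵐ ζ ∂μ, poissonWeight ζ z ≤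
      ENNReal.ofReal (1 / η ^ 2) * ENNReal.ofReal (1 - ‖z‖ ^ 2) := by
    have hs : ∀ᵐ ζ ∂μ, ζ ∈ msupport μ := mem_ae_iff.mpr (measure_compl_msupport μ)
    filter_upwards [hs, hμ.ae_norm_eq_one] with ζ hζ hζ1
    rw [poissonWeight, norm_one_sub_conj_mul hζ1, ← ENNReal.ofReal_mul (by positivity)]
    refine ENNReal.ofReal_le_ofReal ?_
    have h2 : η ≤ ‖ζ - z‖ := by
      by_contra! hlt
      refine hzn (mem_thickening_iff.mpr ⟨ζ, hζ, ?_⟩)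
      rwa [dist_comm, dist_eq_norm]
    rw [one_div_mul_eq_div]
    gcongr
  calc weight μ z ≤ ∫⁻ _, ENNReal.ofReal (1 / η ^ 2) * ENNReal.ofReal (1 - ‖z‖ ^ 2) ∂μ :=
        lintegral_mono_ae h
    _ = _ := by rw [lintegral_const]; ring

/-- Energy is controlled by a derivative bound near the support of `μ` and the unweighted
energy elsewhere. -/
lemma energy_le_of_deriv_le_near {μ : Measure ℂ} [IsFiniteMeasure μ] (hμ : OnCircle μ)
    {η : ℝ} (hη : 0 < η) {F f : ℂ → ℂ} {A B : ℝ≥0∞}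
    (hC : ∀ z ∈ disc, z ∈ thickening η (msupport μ) →
      ‖deriv F z‖ₑ ^ 2 ≤ A + B * ‖deriv f z‖ₑ ^ 2) :
    energy (μ + Measure.dirac 0) F ≤
      A * discMeasure (μ + Measure.dirac 0) univ + B * energy (μ + Measure.dirac 0) f +
      (ENNReal.ofReal (1 / η ^ 2) * μ univ + 1) * energy (Measure.dirac 0) F := by
  have hg := measurable_energy_integrand F
  have hf := measurable_energy_integrand f
  have hw := measurable_weight (μ + Measure.dirac 0)
  have hgw : Measurable fun z => ‖deriv F z‖ₑ ^ 2 * weight (Measure.dirac 0) z :=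
    hg.mul (measurable_weight (Measure.dirac 0))
  have hfw : Measurable fun z => ‖deriv f z‖ₑ ^ 2 * weight (μ + Measure.dirac 0) z := hf.mul hw
  have h1 : discMeasure (μ + Measure.dirac 0) univ =
      ∫⁻ z in disc, 1 * weight (μ + Measure.dirac 0) z := by
    rw [← lintegral_discMeasure' _ measurable_const, lintegral_one]
  have hsum : Measurable fun z => A * (1 * weight (μ + Measure.dirac 0) z) +
      B * (‖deriv f z‖ₑ ^ 2 * weight (μ + Measure.dirac 0) z) :=
    ((hw.const_mul 1).const_mul A).add (hfw.const_mul B)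
  rw [h1, energy, energy, energy, lintegral_discMeasure' _ hg, lintegral_discMeasure' _ hg,
    lintegral_discMeasure' _ hf, ← lintegral_const_mul _ (hw.const_mul 1),
    ← lintegral_const_mul _ hgw, ← lintegral_const_mul _ hfw,
    ← lintegral_add_left ((hw.const_mul 1).const_mul _),
    ← lintegral_add_left hsum]
  refine setLIntegral_mono' isOpen_disc.measurableSet fun z hz => ?_
  by_cases hzN : z ∈ thickening η (msupport μ)
  · refine le_add_right ?_
    calc _ ≤ (A + B * ‖deriv f z‖ₑ ^ 2) * weight (μ + Measure.dirac 0) z := by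
          gcongr
          exact hC z hz hzN
      _ = _ := by ring
  · refine le_add_left ?_
    have h2 : weight (Measure.dirac 0) z = ENNReal.ofReal (1 - ‖z‖ ^ 2) := by
      rw [weight, lintegral_dirac, poissonWeight_zero]
    have h3 : weight (μ + Measure.dirac 0) z ≤
        (ENNReal.ofReal (1 / η ^ 2) * μ univ + 1) * weight (Measure.dirac 0) z := by
      rw [weight, lintegral_add_measure, add_mul, one_mul]
      refine add_le_add ?_ le_rfl
      rw [h2]
      exact weight_le_of_notMem_thickening hμ hη hz hzN
    calc _ ≤ ‖deriv F z‖ₑ ^ 2 * ((ENNReal.ofReal (1 / η ^ 2) * μ univ + 1) *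
          weight (Measure.dirac 0) z) := by gcongr
      _ = _ := by ring

/-- The Herglotz integral of a boundary function. -/
def herglotz (v : ℝ → ℝ) (z : ℂ) : ℂ :=
  ((2 * Real.pi : ℝ) : ℂ)⁻¹ *
    ∫ t in (0:ℝ)..(2 * Real.pi), ((bpt t + z) / (bpt t - z)) * (v t : ℂ)

lemma one_sub_norm_le (z : ℂ) (t : ℝ) : 1 - ‖z‖ ≤ ‖bpt t - z‖ := by
  have := norm_sub_norm_le (bpt t) z
  rwa [norm_bpt] at this

lemma bpt_sub_ne_zero {z : ℂ} (hz : z ∈ disc) (t : ℝ) : bpt t - z ≠ 0 := by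
  have h1 := one_sub_norm_le z t
  have h2 := mem_disc.mp hz
  exact norm_pos_iff.mp (by linarith)

/-- The Poisson kernel of the disc in the boundary parameter. -/
def poissonK (z : ℂ) (t : ℝ) : ℝ := (1 - ‖z‖ ^ 2) / ‖bpt t - z‖ ^ 2

lemma continuous_poissonK {z : ℂ} (hz : z ∈ disc) : Continuous (poissonK z) := by
  refine continuous_const.div ?_ fun t => ?_
  · exact ((continuous_bpt.sub continuous_const).norm).pow 2
  · exact pow_ne_zero 2 (norm_ne_zero_iff.mpr (bpt_sub_ne_zero hz t))

lemma poissonK_nonneg {z : ℂ} (hz : z ∈ disc) (t : ℝ) : 0 ≤ poissonK z t := by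
  have := mem_disc.mp hz
  have : 0 ≤ 1 - ‖z‖ ^ 2 := by nlinarith [norm_nonneg z]
  rw [poissonK]
  positivity

lemma re_herglotz_kernel (z : ℂ) (t : ℝ) : ((bpt t + z) / (bpt t - z)).re = poissonK z t := by
  have := congrFun (poissonKernel_eq_re_herglotzRieszKernel (c := 0) (w := z)) (bpt t)
  rw [Function.comp_apply, poissonKernel_def, herglotzRieszKernel_def] at this
  simp only [sub_zero, norm_bpt, one_pow] at this
  exact this.symm

lemma integral_poissonK {z : ℂ} (hz : z ∈ disc) :
    ∫ t in (0:ℝ)..(2 * Real.pi), poissonK z t = 2 * Real.pi := by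
  have h := DiffContOnCl.circleAverage_poissonKernel_smul' (f := fun _ => (1 : ℂ)) (c := 0)
    diffContOnCl_const hz
  have hb : ∀ t : ℝ, circleMap 0 1 t = bpt t := fun t => by
    rw [circleMap_zero, bpt, ofReal_one, one_mul, mul_comm]
  rw [Real.circleAverage_def] at h
  simp only [hb, sub_zero, norm_bpt, one_pow, real_smul, mul_one] at h
  rw [intervalIntegral.integral_ofReal, ← ofReal_mul, ofReal_eq_one] at h
  have hpi : (2 * Real.pi) ≠ 0 := by positivity
  calc _ = 2 * Real.pi * ((2 * Real.pi)⁻¹ * ∫ t in (0:ℝ)..(2 * Real.pi), poissonK z t) := by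
        field_simp
    _ = 2 * Real.pi := by
        rw [show (2 * Real.pi)⁻¹ * ∫ t in (0:ℝ)..(2 * Real.pi), poissonK z t = 1 from h, mul_one]

lemma intervalIntegrable_herglotz {v : ℝ → ℝ}
    (hv : IntervalIntegrable v volume 0 (2 * Real.pi)) {k : ℝ → ℂ} (hk : Continuous k) :
    IntervalIntegrable (fun t => k t * (v t : ℂ)) volume 0 (2 * Real.pi) := by
  have h : IntervalIntegrable (fun t => (v t : ℂ)) volume 0 (2 * Real.pi) := by
    rw [intervalIntegrable_iff] at hv ⊢
    exact hv.ofReal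
  exact h.continuousOn_mul hk.continuousOn

lemma continuous_herglotz_kernel {z : ℂ} (hz : z ∈ disc) :
    Continuous fun t => (bpt t + z) / (bpt t - z) :=
  (continuous_bpt.add continuous_const).div (continuous_bpt.sub continuous_const)
    (bpt_sub_ne_zero hz)

lemma herglotz_sub {v w : ℝ → ℝ} (hv : IntervalIntegrable v volume 0 (2 * Real.pi))
    (hw : IntervalIntegrable w volume 0 (2 * Real.pi)) {z : ℂ} (hz : z ∈ disc) :
    herglotz (fun t => v t - w t) z = herglotz v z - herglotz w z := by
  simp only [herglotz, ofReal_sub, mul_sub]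
  have hk := continuous_herglotz_kernel hz
  rw [intervalIntegral.integral_sub (intervalIntegrable_herglotz hv hk)
    (intervalIntegrable_herglotz hw hk), mul_sub]

lemma re_herglotz {v : ℝ → ℝ} (hv : IntervalIntegrable v volume 0 (2 * Real.pi)) {z : ℂ}
    (hz : z ∈ disc) :
    (herglotz v z).re = (2 * Real.pi)⁻¹ * ∫ t in (0:ℝ)..(2 * Real.pi), poissonK z t * v t := by
  have h := reCLM.intervalIntegral_comp_comm
    (intervalIntegrable_herglotz hv (continuous_herglotz_kernel hz))
  simp only [reCLM_apply, re_mul_ofReal, re_herglotz_kernel] at h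
  rw [herglotz, ← ofReal_inv, re_ofReal_mul, ← h]

lemma re_herglotz_le {v g : ℝ → ℝ} (hv : IntervalIntegrable v volume 0 (2 * Real.pi))
    (hg : IntervalIntegrable g volume 0 (2 * Real.pi)) {z : ℂ} (hz : z ∈ disc) {c : ℝ}
    (h : ∀ t, poissonK z t * v t ≤ poissonK z t * c + g t) :
    (herglotz v z).re ≤ c + (2 * Real.pi)⁻¹ * ∫ t in (0:ℝ)..(2 * Real.pi), g t := by
  have hk := continuous_poissonK hz
  have hkc : IntervalIntegrable (fun t => poissonK z t * c) volume 0 (2 * Real.pi) :=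
    (hk.mul continuous_const).intervalIntegrable _ _
  have h1 : ∫ t in (0:ℝ)..(2 * Real.pi), poissonK z t * v t ≤
      ∫ t in (0:ℝ)..(2 * Real.pi), (poissonK z t * c + g t) :=
    intervalIntegral.integral_mono_on (by positivity) (hv.continuousOn_mul hk.continuousOn)
      (hkc.add hg) fun t _ => h t
  rw [intervalIntegral.integral_add hkc hg, intervalIntegral.integral_mul_const,
    integral_poissonK hz] at h1
  rw [re_herglotz hv hz]
  calc _ ≤ (2 * Real.pi)⁻¹ * (2 * Real.pi * c + ∫ t in (0:ℝ)..(2 * Real.pi), g t) := by gcongr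
    _ = _ := by field_simp

/-- Bound for `(2π)⁻¹ ∫ k v` from a bound on `k` where `v` does not vanish. -/
lemma norm_mean_mul_le {v : ℝ → ℝ} (hv : IntervalIntegrable v volume 0 (2 * Real.pi))
    {k : ℝ → ℂ} {C : ℝ} (h : ∀ t, v t ≠ 0 → ‖k t‖ ≤ C) :
    ‖((2 * Real.pi : ℝ) : ℂ)⁻¹ * ∫ t in (0:ℝ)..(2 * Real.pi), k t * (v t : ℂ)‖ ≤
      C * ∫ t in (0:ℝ)..(2 * Real.pi), |v t| := by
  have hpi : (2 * Real.pi)⁻¹ ≤ 1 := inv_le_one_of_one_le₀ (by linarith [Real.pi_gt_three])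
  rw [norm_mul, norm_inv, Complex.norm_real, Real.norm_of_nonneg (by positivity)]
  refine (mul_le_of_le_one_left (norm_nonneg _) hpi).trans ?_
  rw [← intervalIntegral.integral_const_mul]
  refine intervalIntegral.norm_integral_le_of_norm_le (by positivity)
    (Eventually.of_forall fun t _ => ?_) (hv.abs.const_mul C)
  rw [norm_mul, Complex.norm_real, Real.norm_eq_abs]
  by_cases h0 : v t = 0
  · simp [h0]
  · exact mul_le_mul_of_nonneg_right (h t h0) (abs_nonneg _)

lemma norm_herglotz_le {v : ℝ → ℝ} (hv : IntervalIntegrable v volume 0 (2 * Real.pi)) {z : ℂ}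
    (hz : z ∈ disc) :
    ‖herglotz v z‖ ≤ 2 / (1 - ‖z‖) * ∫ t in (0:ℝ)..(2 * Real.pi), |v t| := by
  refine norm_mean_mul_le hv fun t _ => ?_
  have h2 := mem_disc.mp hz
  have h3 : 0 < 1 - ‖z‖ := by linarith
  rw [norm_div]
  have h4 := norm_add_le (bpt t) z
  rw [norm_bpt] at h4
  gcongr
  · linarith
  · exact one_sub_norm_le z t

lemma hasDerivAt_herglotz {v : ℝ → ℝ} (hv : IntervalIntegrable v volume 0 (2 * Real.pi)) {z : ℂ}
    (hz : z ∈ disc) :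
    HasDerivAt (herglotz v) (((2 * Real.pi : ℝ) : ℂ)⁻¹ *
      ∫ t in (0:ℝ)..(2 * Real.pi), (2 * bpt t / (bpt t - z) ^ 2) * (v t : ℂ)) z := by
  have h2 := mem_disc.mp hz
  set ρ := (1 - ‖z‖) / 2 with hρ
  have hρ0 : 0 < ρ := by rw [hρ]; linarith
  have hball : ∀ x ∈ ball z ρ, ∀ t, ρ ≤ ‖bpt t - x‖ := fun x hx t => by
    have h3 := one_sub_norm_le x t
    have h4 := norm_sub_norm_le x z
    rw [mem_ball, dist_eq_norm] at hx
    linarith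
  have hdisc : ∀ x ∈ ball z ρ, x ∈ disc := fun x hx => by
    have h4 := norm_sub_norm_le x z
    rw [mem_ball, dist_eq_norm] at hx
    rw [mem_disc]
    linarith
  have hk2 : Continuous fun t => 2 * bpt t / (bpt t - z) ^ 2 :=
    (continuous_const.mul continuous_bpt).div ((continuous_bpt.sub continuous_const).pow 2)
      fun t => pow_ne_zero 2 (bpt_sub_ne_zero hz t)
  refine HasDerivAt.const_mul _ (intervalIntegral.hasDerivAt_integral_of_dominated_loc_of_deriv_le
    (F := fun z t => (bpt t + z) / (bpt t - z) * (v t : ℂ))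
    (F' := fun z t => (2 * bpt t / (bpt t - z) ^ 2) * (v t : ℂ))
    (bound := fun t => 2 / ρ ^ 2 * |v t|)
    (ball_mem_nhds z hρ0) ?_ ?_ ?_ ?_ ?_ ?_).2
  · filter_upwards [isOpen_disc.mem_nhds hz] with x hx
    exact (intervalIntegrable_herglotz hv
      (continuous_herglotz_kernel hx)).def'.aestronglyMeasurable
  · exact intervalIntegrable_herglotz hv (continuous_herglotz_kernel hz)
  · exact (intervalIntegrable_herglotz hv hk2).def'.aestronglyMeasurable
  · refine Eventually.of_forall fun t _ x hx => ?_
    rw [norm_mul, norm_div, norm_mul, norm_pow, norm_bpt, Complex.norm_real, Real.norm_eq_abs,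
      Complex.norm_ofNat, mul_one]
    have := hball x hx t
    gcongr
  · exact hv.abs.const_mul _
  · refine Eventually.of_forall fun t _ x hx => ?_
    have hne := bpt_sub_ne_zero (hdisc x hx) t
    have h5 := ((hasDerivAt_id x).const_add (bpt t)).div ((hasDerivAt_id x).const_sub (bpt t)) hne
    refine (h5.mul_const (v t : ℂ)).congr_deriv ?_
    simp only [id]
    congr 2
    ring

lemma differentiableOn_herglotz {v : ℝ → ℝ}
    (hv : IntervalIntegrable v volume 0 (2 * Real.pi)) : DifferentiableOn ℂ (herglotz v) disc :=
  fun _ hz => (hasDerivAt_herglotz hv hz).differentiableAt.differentiableWithinAt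

lemma norm_deriv_herglotz_le {v : ℝ → ℝ} (hv : IntervalIntegrable v volume 0 (2 * Real.pi))
    {z : ℂ} (hz : z ∈ disc) {ρ : ℝ} (hρ : 0 < ρ) (h : ∀ t, v t ≠ 0 → ρ ≤ ‖bpt t - z‖) :
    ‖deriv (herglotz v) z‖ ≤ 2 / ρ ^ 2 * ∫ t in (0:ℝ)..(2 * Real.pi), |v t| := by
  rw [(hasDerivAt_herglotz hv hz).deriv]
  refine norm_mean_mul_le hv fun t ht => ?_
  rw [norm_div, norm_mul, norm_pow, norm_bpt, Complex.norm_ofNat, mul_one]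
  have := h t ht
  gcongr

/-- The truncation `min (u + log (n + 1)) 0`, set to `0` where the boundary point lies in `E`. -/
def truncate (u : ℝ → ℝ) (E : Set ℂ) (n : ℕ) : ℝ → ℝ :=
  (bpt ⁻¹' E)ᶜ.indicator fun t => min (u t + Real.log (n + 1)) 0

lemma log_succ_nonneg (n : ℕ) : 0 ≤ Real.log ((n : ℝ) + 1) :=
  Real.log_nonneg (by linarith [n.cast_nonneg (α := ℝ)])

lemma truncate_nonpos (u : ℝ → ℝ) (E : Set ℂ) (n : ℕ) (t : ℝ) : truncate u E n t ≤ 0 :=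
  Set.indicator_nonpos (fun _ _ => min_le_right _ _) t

lemma abs_truncate_le (u : ℝ → ℝ) (E : Set ℂ) (n : ℕ) (t : ℝ) : |truncate u E n t| ≤ |u t| := by
  have hl := log_succ_nonneg n
  rw [truncate, Set.indicator]
  split_ifs
  · rw [abs_of_nonpos (min_le_right _ _)]
    rcases min_cases (u t + Real.log (n + 1)) 0 with h | h
    · linarith [neg_abs_le (u t)]
    · rw [h.1, neg_zero]
      exact abs_nonneg _
  · simp

lemma notMem_of_truncate_ne_zero {u : ℝ → ℝ} {E : Set ℂ} {n : ℕ} {t : ℝ}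
    (h : truncate u E n t ≠ 0) : bpt t ∉ E := Set.mem_of_indicator_ne_zero h

lemma intervalIntegrable_truncate {u : ℝ → ℝ} (hu : IntervalIntegrable u volume 0 (2 * Real.pi))
    {E : Set ℂ} (hE : IsOpen E) (n : ℕ) :
    IntervalIntegrable (truncate u E n) volume 0 (2 * Real.pi) := by
  refine hu.mono_fun ?_ (Eventually.of_forall fun t => ?_)
  · exact ((hu.def'.aestronglyMeasurable.add aestronglyMeasurable_const).inf
      aestronglyMeasurable_const).indicator (hE.preimage continuous_bpt).measurableSet.compl
  · simpa only [Real.norm_eq_abs] using abs_truncate_le u E n t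

lemma tendsto_integral_abs_truncate {u : ℝ → ℝ}
    (hu : IntervalIntegrable u volume 0 (2 * Real.pi)) {E : Set ℂ} (hE : IsOpen E) :
    Tendsto (fun n => ∫ t in (0:ℝ)..(2 * Real.pi), |truncate u E n t|) atTop (𝓝 0) := by
  have h := intervalIntegral.tendsto_integral_filter_of_dominated_convergence (l := atTop)
    (μ := volume) (a := 0) (b := 2 * Real.pi) (F := fun n t => |truncate u E n t|)
    (f := fun _ => (0 : ℝ)) (fun t => |u t|) ?_ ?_ hu.abs ?_
  · simpa using h
  · exact Eventually.of_forall fun n =>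
      (intervalIntegrable_truncate hu hE n).abs.def'.aestronglyMeasurable
  · refine Eventually.of_forall fun n => Eventually.of_forall fun t _ => ?_
    rw [Real.norm_eq_abs, abs_abs]
    exact abs_truncate_le u E n t
  · refine Eventually.of_forall fun t _ => ?_
    have hlog : Tendsto (fun n : ℕ => Real.log ((n : ℝ) + 1)) atTop atTop :=
      Real.tendsto_log_atTop.comp (tendsto_atTop_add_const_right _ _ tendsto_natCast_atTop_atTop)
    refine tendsto_const_nhds.congr' ?_
    filter_upwards [hlog.eventually_ge_atTop (-u t)] with n hn
    rw [truncate, Set.indicator]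
    split_ifs
    · rw [min_eq_right (by linarith), abs_zero]
    · rw [abs_zero]

/-- The outer function with boundary log-modulus `v`. -/
def outer (v : ℝ → ℝ) (z : ℂ) : ℂ := Complex.exp (herglotz v z)

lemma differentiableOn_outer {v : ℝ → ℝ} (hv : IntervalIntegrable v volume 0 (2 * Real.pi)) :
    DifferentiableOn ℂ (outer v) disc := (differentiableOn_herglotz hv).cexp

lemma norm_outer_le {v g : ℝ → ℝ} (hv : IntervalIntegrable v volume 0 (2 * Real.pi))
    (hg : IntervalIntegrable g volume 0 (2 * Real.pi)) {z : ℂ} (hz : z ∈ disc) {c : ℝ}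
    (h : ∀ t, poissonK z t * v t ≤ poissonK z t * c + g t) :
    ‖outer v z‖ ≤ Real.exp (c + (2 * Real.pi)⁻¹ * ∫ t in (0:ℝ)..(2 * Real.pi), g t) := by
  rw [outer, Complex.norm_exp]
  exact Real.exp_le_exp.mpr (re_herglotz_le hv hg hz h)

lemma norm_outer_le_one {v : ℝ → ℝ} (hv : IntervalIntegrable v volume 0 (2 * Real.pi))
    (h : ∀ t, v t ≤ 0) {z : ℂ} (hz : z ∈ disc) : ‖outer v z‖ ≤ 1 := by
  have := norm_outer_le (g := fun _ => 0) (c := 0) hv (by simp) hz fun t => by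
    rw [mul_zero, add_zero]
    exact mul_nonpos_of_nonneg_of_nonpos (poissonK_nonneg hz t) (h t)
  simpa using this

lemma norm_deriv_outer_le {v : ℝ → ℝ} (hv : IntervalIntegrable v volume 0 (2 * Real.pi))
    (h0 : ∀ t, v t ≤ 0) {z : ℂ} (hz : z ∈ disc) {ρ : ℝ} (hρ : 0 < ρ)
    (h : ∀ t, v t ≠ 0 → ρ ≤ ‖bpt t - z‖) :
    ‖deriv (outer v) z‖ ≤ 2 / ρ ^ 2 * ∫ t in (0:ℝ)..(2 * Real.pi), |v t| := by
  have hd := ((hasDerivAt_herglotz hv hz).differentiableAt.hasDerivAt).cexp.deriv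
  have h1 := norm_outer_le_one hv h0 hz
  rw [show outer v = fun z => Complex.exp (herglotz v z) from rfl, hd, norm_mul]
  exact (mul_le_of_le_one_left (norm_nonneg _) h1).trans (norm_deriv_herglotz_le hv hz hρ h)

lemma tendsto_outer_one {v : ℕ → ℝ → ℝ}
    (hv : ∀ n, IntervalIntegrable (v n) volume 0 (2 * Real.pi))
    (h : Tendsto (fun n => ∫ t in (0:ℝ)..(2 * Real.pi), |v n t|) atTop (𝓝 0)) {z : ℂ}
    (hz : z ∈ disc) : Tendsto (fun n => outer (v n) z) atTop (𝓝 1) := by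
  have h1 : Tendsto (fun n => herglotz (v n) z) atTop (𝓝 0) := by
    refine squeeze_zero_norm (fun n => norm_herglotz_le (hv n) hz) ?_
    simpa using h.const_mul (2 / (1 - ‖z‖))
  have := (Complex.continuous_exp.tendsto 0).comp h1
  rwa [Complex.exp_zero] at this

lemma two_mul_le_of_notMem_thickening {S : Set ℂ} {η ρ : ℝ} {z w : ℂ}
    (hz : z ∉ thickening (η + ρ) S) (hw : w ∈ thickening ρ S) : η ≤ ‖w - z‖ := by
  obtain ⟨ζ, hζ, hd⟩ := mem_thickening_iff.mp hw
  by_contra! hlt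
  refine hz (mem_thickening_iff.mpr ⟨ζ, hζ, ?_⟩)
  rw [← dist_eq_norm, dist_comm] at hlt
  linarith [dist_triangle z w ζ]

lemma OuterWith.eq_outer {f : ℂ → ℂ} {φ : ℝ → ℝ} (h : OuterWith f φ) {z : ℂ} (hz : z ∈ disc) :
    f z = outer (fun t => Real.log (φ t)) z := h.2.2 z hz

/-- The outer function `F` with `F f = outer (truncate u E n)` is bounded. -/
lemma exists_norm_quotient_le {f : ℂ → ℂ} {u : ℝ → ℝ}
    (hu : IntervalIntegrable u volume 0 (2 * Real.pi))
    {S : Set ℂ} {δ η : ℝ} (hδ : 0 < δ) (hη : 0 < η)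
    (hlow : ∀ z ∈ disc, z ∈ thickening (2 * η) S → δ ≤ ‖f z‖) (n : ℕ)
    (hGF : ∀ z ∈ disc, outer (fun t => truncate u (thickening η S) n t - u t) z * f z =
      outer (truncate u (thickening η S) n) z) :
    ∃ M, ∀ z ∈ disc, ‖outer (fun t => truncate u (thickening η S) n t - u t) z‖ ≤ M := by
  have hv := intervalIntegrable_truncate hu (isOpen_thickening (δ := η) (E := S)) n
  refine ⟨max (1 / δ) (Real.exp (Real.log (n + 1) + (2 * Real.pi)⁻¹ *
    ∫ t in (0:ℝ)..(2 * Real.pi), 1 / η ^ 2 * |u t|)), fun z hz => ?_⟩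
  by_cases hzS : z ∈ thickening (2 * η) S
  · refine le_max_of_le_left ?_
    have h1 := norm_outer_le_one hv (truncate_nonpos u _ n) hz
    rw [← hGF z hz, norm_mul] at h1
    rw [le_div_iff₀ hδ]
    exact (mul_le_mul_of_nonneg_left (hlow z hz hzS) (norm_nonneg _)).trans h1
  · refine le_max_of_le_right (norm_outer_le (hv.sub hu) (hu.abs.const_mul _) hz fun t => ?_)
    have hp := poissonK_nonneg hz t
    have hl := log_succ_nonneg n
    by_cases ht : bpt t ∈ thickening η S
    · have h0 : truncate u (thickening η S) n t = 0 := by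
        by_contra h
        exact notMem_of_truncate_ne_zero h ht
      have h2 : η ≤ ‖bpt t - z‖ := two_mul_le_of_notMem_thickening (by rwa [← two_mul]) ht
      have h3 : poissonK z t ≤ 1 / η ^ 2 := by
        rw [poissonK]
        gcongr
        nlinarith [norm_nonneg z]
      rw [h0, zero_sub]
      have h4 := mul_le_mul_of_nonneg_left (neg_le_abs (u t)) hp
      have h5 := mul_le_mul_of_nonneg_right h3 (abs_nonneg (u t))
      have h6 := mul_nonneg hp hl
      linarith
    · have h0 : truncate u (thickening η S) n t = min (u t + Real.log (n + 1)) 0 :=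
        Set.indicator_of_mem (show t ∈ (bpt ⁻¹' thickening η S)ᶜ from ht) _
      have h1 : truncate u (thickening η S) n t - u t ≤ Real.log (n + 1) := by
        rw [h0]
        linarith [min_le_left (u t + Real.log (n + 1)) 0]
      have h2 := mul_le_mul_of_nonneg_left h1 hp
      have h3 : 0 ≤ 1 / η ^ 2 * |u t| := by positivity
      linarith

/-- Bounded functions `F n` of finite energy for which `F n * f` tends to `1`. -/
lemma exists_approx_inverse {μ : Measure ℂ} [IsFiniteMeasure μ] (hμ : OnCircle μ) {f : ℂ → ℂ}
    (hfD : MemD μ f) (hfH : MemHinf f) (hfO : IsOuter f) (hdisj : Zlow f ∩ msupport μ = ∅) :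
    ∃ F : ℕ → ℂ → ℂ, (∀ n, DifferentiableOn ℂ (F n) disc) ∧
      (∀ n, ∃ M, ∀ z ∈ disc, ‖F n z‖ ≤ M) ∧ (∀ n, energy (μ + Measure.dirac 0) (F n) ≠ ∞) ∧
      (∀ n, ∀ z ∈ disc, ‖F n z * f z‖ ≤ 1) ∧
      (∀ z ∈ disc, Tendsto (fun n => F n z * f z) atTop (𝓝 1)) ∧
      Tendsto (fun n => energy (μ + Measure.dirac 0) (fun z => F n z * f z)) atTop (𝓝 0) := by
  obtain ⟨φ, hφ⟩ := hfO
  set u : ℝ → ℝ := fun t => Real.log (φ t) with hu_def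
  have hu : IntervalIntegrable u volume 0 (2 * Real.pi) := hφ.2.1
  have hfu : ∀ z ∈ disc, f z = outer u z := fun z hz => hφ.eq_outer hz
  have hfd := hfH.1
  have hμ1 : ∀ᵐ ζ ∂μ, ‖ζ‖ ≤ 1 := hμ.ae_norm_eq_one.mono fun _ h => h.le
  have hν1 : ∀ᵐ ζ ∂(μ + Measure.dirac 0), ‖ζ‖ ≤ 1 := by
    rw [ae_add_measure_iff]
    exact ⟨hμ1, by rw [ae_dirac_eq]; simp⟩
  have hfe := energy_ne_top_of_memD μ hμ1 hfD
  obtain ⟨δ, hδ, η, hη, hlow⟩ := exists_lower_bound_near_compact hfH hμ.isCompact_msupport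
    (hμ.msupport_subset.trans sphere_subset_closedBall) hdisj
  set S := msupport μ
  set v := truncate u (thickening η S) with hv_def
  have hvi : ∀ n, IntervalIntegrable (v n) volume 0 (2 * Real.pi) :=
    intervalIntegrable_truncate hu isOpen_thickening
  have hv0 : ∀ n t, v n t ≤ 0 := truncate_nonpos u _
  have hI := tendsto_integral_abs_truncate hu (isOpen_thickening (δ := η) (E := S))
  set I : ℕ → ℝ := fun n => ∫ t in (0:ℝ)..(2 * Real.pi), |v n t| with hI_def
  have hwi : ∀ n, IntervalIntegrable (fun t => v n t - u t) volume 0 (2 * Real.pi) :=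
    fun n => (hvi n).sub hu
  have hGF : ∀ n, ∀ z ∈ disc, outer (fun t => v n t - u t) z * f z = outer (v n) z := by
    intro n z hz
    rw [hfu z hz, outer, outer, outer, ← Complex.exp_add, herglotz_sub (hvi n) hu hz,
      sub_add_cancel]
  have hGd := fun n => differentiableOn_outer (hvi n)
  have hFd := fun n => differentiableOn_outer (hwi n)
  have hG1 : ∀ n, ∀ z ∈ disc, ‖outer (v n) z‖ ≤ 1 :=
    fun n z hz => norm_outer_le_one (hvi n) (hv0 n) hz
  have hFM := fun n => exists_norm_quotient_le hu hδ hη hlow n (hGF n)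
  have hη2 : 0 < η / 2 := half_pos hη
  have hG' : ∀ n, ∀ z ∈ disc, z ∈ thickening (η / 2) S →
      ‖deriv (outer (v n)) z‖ ≤ 2 / (η / 2) ^ 2 * I n := by
    intro n z hz hzS
    refine norm_deriv_outer_le (hvi n) (hv0 n) hz hη2 fun t ht => ?_
    rw [norm_sub_rev]
    exact two_mul_le_of_notMem_thickening
      (by rw [add_halves]; exact notMem_of_truncate_ne_zero ht) hzS
  have hm := isFiniteMeasure_discMeasure _ hν1
  have hK : ENNReal.ofReal (1 / (η / 2) ^ 2) * μ univ + 1 ≠ ∞ :=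
    ENNReal.add_ne_top.mpr ⟨ENNReal.mul_ne_top (by simp) (measure_ne_top _ _), by simp⟩
  refine ⟨fun n => outer (fun t => v n t - u t), hFd, hFM, fun n => ?_, fun n z hz => ?_,
    fun z hz => ?_, ?_⟩
  · obtain ⟨M, hM⟩ := hFM n
    have hbound := energy_le_of_deriv_le_near hμ hη2 (F := outer (fun t => v n t - u t)) (f := f)
      (A := 2 * ENNReal.ofReal (2 / (η / 2) ^ 2 * I n / δ) ^ 2)
      (B := 2 * ENNReal.ofReal (M / δ) ^ 2) ?_
    · refine ne_top_of_le_ne_top ?_ hbound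
      refine ENNReal.add_ne_top.mpr ⟨ENNReal.add_ne_top.mpr ⟨ENNReal.mul_ne_top
        (ENNReal.mul_ne_top (by simp) (by simp)) (measure_ne_top _ _), ENNReal.mul_ne_top
        (ENNReal.mul_ne_top (by simp) (by simp)) hfe⟩, ENNReal.mul_ne_top hK ?_⟩
      exact ne_top_of_le_ne_top ENNReal.ofReal_ne_top
        (energy_dirac_zero_le (hFd n) fun x => hardySet_le_of_norm_le (hFd n) hM)
    · intro z hz hzS
      have hδf : δ ≤ ‖f z‖ := hlow z hz (thickening_mono (by linarith) _ hzS)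
      have hf0 : f z ≠ 0 := norm_pos_iff.mp (hδ.trans_le hδf)
      have hd : deriv (outer fun t => v n t - u t) z = deriv (outer (v n)) z / f z +
          -(outer (fun t => v n t - u t) z / f z) * deriv f z := by
        have h1 := deriv_eqOn_disc (hGF n) hz
        rw [deriv_fun_mul (differentiableAt_of_mem (hFd n) hz) (differentiableAt_of_mem hfd hz)]
          at h1
        field_simp
        linear_combination h1
      have hM0 : 0 ≤ M := (norm_nonneg _).trans (hM z hz)
      rw [hd]
      refine (enorm_add_sq_le _ _).trans ?_
      rw [enorm_mul, enorm_neg, mul_pow, ← mul_assoc]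
      have e1 : ‖deriv (outer (v n)) z / f z‖ₑ ≤ ENNReal.ofReal (2 / (η / 2) ^ 2 * I n / δ) := by
        refine enorm_le_ofReal ?_
        rw [norm_div]
        exact div_le_div₀ ((norm_nonneg _).trans (hG' n z hz hzS)) (hG' n z hz hzS) hδ hδf
      have e2 : ‖outer (fun t => v n t - u t) z / f z‖ₑ ≤ ENNReal.ofReal (M / δ) := by
        refine enorm_le_ofReal ?_
        rw [norm_div]
        exact div_le_div₀ hM0 (hM z hz) hδ hδf
      gcongr
  · rw [hGF n z hz]
    exact hG1 n z hz
  · refine (tendsto_outer_one hvi hI hz).congr fun n => (hGF n z hz).symm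
  · have hG0 := tendsto_outer_one hvi hI (show (0 : ℂ) ∈ disc by simp [mem_disc])
    have e1 : ∀ n, energy (μ + Measure.dirac 0)
        (fun z => outer (fun t => v n t - u t) z * f z) ≤
        ENNReal.ofReal (2 / (η / 2) ^ 2 * I n) ^ 2 * discMeasure (μ + Measure.dirac 0) univ +
        (ENNReal.ofReal (1 / (η / 2) ^ 2) * μ univ + 1) *
          ENNReal.ofReal (4 * (1 ^ 2 - ‖outer (v n) 0‖ ^ 2)) := by
      intro n
      rw [energy_congr _ (hGF n)]
      have hbound := energy_le_of_deriv_le_near hμ hη2 (F := outer (v n)) (f := f)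
        (A := ENNReal.ofReal (2 / (η / 2) ^ 2 * I n) ^ 2) (B := 0) fun z hz hzS => by
          rw [zero_mul, add_zero]
          have := enorm_le_ofReal (hG' n z hz hzS)
          gcongr
      rw [zero_mul, add_zero] at hbound
      refine hbound.trans ?_
      gcongr
      exact energy_dirac_zero_le (hGd n) fun x => hardySet_le_of_norm_le (hGd n) (hG1 n)
    refine tendsto_of_tendsto_of_tendsto_of_le_of_le tendsto_const_nhds ?_ (fun _ => zero_le) e1
    have t1 : Tendsto (fun n => ENNReal.ofReal (2 / (η / 2) ^ 2 * I n) ^ 2) atTop (𝓝 0) := by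
      simpa [Function.comp_def] using ((ENNReal.continuous_pow 2).tendsto _).comp
        (ENNReal.tendsto_ofReal (hI.const_mul (2 / (η / 2) ^ 2)))
    have t2 : Tendsto (fun n => ENNReal.ofReal (4 * (1 ^ 2 - ‖outer (v n) 0‖ ^ 2))) atTop
        (𝓝 0) := by
      have := ENNReal.tendsto_ofReal (((hG0.norm.pow 2).const_sub (1 ^ 2)).const_mul 4)
      simpa using this
    have t3 := ENNReal.Tendsto.mul_const (b := discMeasure (μ + Measure.dirac 0) univ) t1
      (Or.inr (measure_ne_top _ _))
    have t4 := ENNReal.Tendsto.const_mul t2 (Or.inr hK)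
    simpa only [zero_mul, mul_zero, add_zero] using t3.add t4

lemma exists_norm_eval_le (p : Polynomial ℂ) : ∃ B, ∀ z ∈ disc, ‖p.eval z‖ ≤ B := by
  obtain ⟨B, hB⟩ := (isCompact_closedBall (0 : ℂ) 1).exists_bound_of_continuousOn
    p.continuous.continuousOn
  exact ⟨B, fun z hz => hB z (ball_subset_closedBall hz)⟩

lemma energy_polynomial_ne_top (ν : Measure ℂ) [IsFiniteMeasure ν] (hν : ∀ᵐ ζ ∂ν, ‖ζ‖ ≤ 1)
    (p : Polynomial ℂ) : energy ν (fun z => p.eval z) ≠ ∞ := by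
  have := isFiniteMeasure_discMeasure ν hν
  obtain ⟨C, hC⟩ := exists_norm_eval_le (Polynomial.derivative p)
  refine ne_top_of_le_ne_top ?_ (energy_le_of_norm_deriv_le ν (C := C) fun z hz => ?_)
  · exact ENNReal.mul_ne_top (by simp) (measure_ne_top _ _)
  · rw [Polynomial.deriv]
    exact hC z hz

lemma exists_energy_lt {ν : Measure ℂ} {a : ℕ → ℂ → ℂ}
    (he : Tendsto (fun n => energy ν (a n)) atTop (𝓝 0))
    (h0 : Tendsto (fun n => a n 0) atTop (𝓝 0)) {κ : ℝ≥0∞} (hκ : 0 < κ) {τ : ℝ} (hτ : 0 < τ) :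
    ∃ n, energy ν (a n) < κ ∧ ‖a n 0‖ < τ := by
  have h1 : ∀ᶠ n in atTop, ‖a n 0‖ < τ := by
    have := h0.norm
    rw [norm_zero] at this
    exact this.eventually_lt_const hτ
  exact ((he.eventually_lt_const hκ).and h1).exists

/-- An outer `f ∈ D(μ) ∩ H^∞` with `Z̲(f) ∩ supp μ = ∅` is cyclic for `D(μ)`. -/
theorem cyclic_of_Zlow_disjoint_support
    (μ : Measure ℂ) [IsFiniteMeasure μ] (hμ : OnCircle μ)
    (f : ℂ → ℂ) (hfD : MemD μ f) (hfH : MemHinf f) (hfO : IsOuter f)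
    (hdisj : Zlow f ∩ msupport μ = ∅) :
    IsCyclic μ f := by
  refine Subset.antisymm (fun g h => h.1) fun g hg => ⟨hg, fun ε hε => ?_⟩
  obtain ⟨F, hFd, hFM, hFe, hFf, hFlim, hFfe⟩ := exists_approx_inverse hμ hfD hfH hfO hdisj
  have hμ1 : ∀ᵐ ζ ∂μ, ‖ζ‖ ≤ 1 := hμ.ae_norm_eq_one.mono fun _ h => h.le
  have hν1 : ∀ᵐ ζ ∂(μ + Measure.dirac 0), ‖ζ‖ ≤ 1 := by
    rw [ae_add_measure_iff]
    exact ⟨hμ1, by rw [ae_dirac_eq]; simp⟩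
  have hfe := energy_ne_top_of_memD μ hμ1 hfD
  have hge := energy_ne_top_of_memD μ hμ1 hg
  set ν := μ + Measure.dirac 0
  obtain ⟨hfd, C, hC⟩ := hfH
  have hgd : DifferentiableOn ℂ g disc := hg.1.1
  have h0 : (0 : ℂ) ∈ disc := by simp [disc]
  have hpd : ∀ q : Polynomial ℂ, DifferentiableOn ℂ (fun z => q.eval z) disc :=
    fun q => q.differentiable.differentiableOn
  have hκ : (0 : ℝ≥0∞) < ENNReal.ofReal (ε / 40) := by
    rw [ENNReal.ofReal_pos]
    positivity
  have hτ : 0 < √(ε / 36) := by positivity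
  obtain ⟨ps, hps, hps0, -⟩ := exists_polynomial_approx ν hν1 hgd hge
  obtain ⟨i, hi, hi0⟩ := exists_energy_lt hps (hps0 0 h0) hκ hτ
  set p := ps i
  obtain ⟨B, hB⟩ := exists_norm_eval_le p
  have hpe := energy_polynomial_ne_top ν hν1 p
  have h1d : ∀ n, DifferentiableOn ℂ (fun z => 1 - F n z * f z) disc :=
    fun n => ((hFd n).fun_mul hfd).const_sub 1
  have h1lim : ∀ z ∈ disc, Tendsto (fun n => 1 - F n z * f z) atTop (𝓝 0) := fun z hz => by
    simpa using (hFlim z hz).const_sub 1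
  have h1e : ∀ n, energy ν (fun z => 1 - F n z * f z) = energy ν (fun z => F n z * f z) :=
    fun n => by
      rw [← energy_sub_const ν _ 1, ← energy_neg]
      exact energy_congr ν fun z _ => by ring
  have h2 : Tendsto (fun n => energy ν (fun z => (1 - F n z * f z) * p.eval z)) atTop (𝓝 0) := by
    refine tendsto_energy_mul ν h1d (hpd p) (A := 2) (fun n z hz => ?_) hB h1lim ?_ hpe
    · have := norm_sub_le 1 (F n z * f z)
      rw [norm_one] at this
      linarith [hFf n z hz]
    · simpa only [h1e] using hFfe
  obtain ⟨n, hn, hn0⟩ := exists_energy_lt h2 (by simpa using (h1lim 0 h0).mul_const (p.eval 0))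
    hκ hτ
  obtain ⟨M, hM⟩ := hFM n
  obtain ⟨qs, hqs, hqs0, hqsM⟩ := exists_polynomial_approx ν hν1 (hFd n) (hFe n)
  have hpfd : DifferentiableOn ℂ (fun z => p.eval z * f z) disc := (hpd p).fun_mul hfd
  have hpfe := energy_mul_ne_top ν (hpd p) hfd hB hC hpe hfe
  have h3 : Tendsto (fun k => energy ν (fun z => (F n z - (qs k).eval z) * (p.eval z * f z)))
      atTop (𝓝 0) := by
    refine tendsto_energy_mul ν (fun k => (hFd n).fun_sub (hpd (qs k))) hpfd
      (A := M + (M + 1)) (B := B * C) (fun k z hz => ?_) (fun z hz => ?_) hqs0 hqs hpfe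
    · exact (norm_sub_le _ _).trans (add_le_add (hM z hz) (hqsM M hM k z hz))
    · rw [norm_mul]
      exact mul_le_mul (hB z hz) (hC z hz) (norm_nonneg _) ((norm_nonneg _).trans (hB z hz))
  obtain ⟨k, hk, hk0⟩ := exists_energy_lt h3
    (by simpa using (hqs0 0 h0).mul_const (p.eval 0 * f 0)) hκ hτ
  set q := qs k
  refine ⟨p * q, ?_⟩
  have hsplit : (fun z => g z - (p * q).eval z * f z) = fun z => (g z - p.eval z) +
      ((1 - F n z * f z) * p.eval z + (F n z - q.eval z) * (p.eval z * f z)) := by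
    funext z
    rw [Polynomial.eval_mul]
    ring
  have hd2 := (h1d n).fun_mul (hpd p)
  have hd3 := ((hFd n).fun_sub (hpd q)).fun_mul hpfd
  have hE : energy ν (fun z => g z - (p * q).eval z * f z) ≤ ENNReal.ofReal (ε / 4) := by
    rw [hsplit]
    refine (energy_add_le ν (hgd.fun_sub (hpd p)) (hd2.fun_add hd3)).trans ?_
    calc _ ≤ 2 * ENNReal.ofReal (ε / 40) +
          2 * (2 * ENNReal.ofReal (ε / 40) + 2 * ENNReal.ofReal (ε / 40)) := by
          gcongr
          refine (energy_add_le ν hd2 hd3).trans ?_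
          gcongr
      _ = ENNReal.ofReal 10 * ENNReal.ofReal (ε / 40) := by
          rw [ENNReal.ofReal_ofNat]
          ring
      _ = ENNReal.ofReal (ε / 4) := by
          rw [← ENNReal.ofReal_mul (by norm_num)]
          congr 1
          ring
  have hd : DifferentiableOn ℂ (fun z => g z - (p * q).eval z * f z) disc :=
    hgd.fun_sub ((hpd _).fun_mul hfd)
  have hval : ‖g 0 - (p * q).eval 0 * f 0‖ ≤ 3 * √(ε / 36) := by
    rw [congrFun hsplit 0]
    refine (norm_add_le _ _).trans ?_
    linarith [norm_add_le ((1 - F n 0 * f 0) * p.eval 0)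
      ((F n 0 - q.eval 0) * (p.eval 0 * f 0))]
  have hsq : ‖g 0 - (p * q).eval 0 * f 0‖ ^ 2 ≤ ε / 4 := by
    calc _ ≤ (3 * √(ε / 36)) ^ 2 := by gcongr
      _ = ε / 4 := by
        rw [mul_pow, Real.sq_sqrt (by positivity)]
        ring
  have hR := ENNReal.toReal_le_of_le_ofReal (by positivity) hE
  have := dNormSq_le μ hd (ne_top_of_le_ne_top ENNReal.ofReal_ne_top hE)
  linarith

end DirichletMu
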